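/- arXiv:2102.07029 — 8 statements merged into one kernel-verified Lean document; each statement's English description precedes it below -/
import Mathlib

section
/- Let p be a prime and G a non-cyclic group of order pⁿ (n ≥ 1). Then σ₁(G) < 2 + 11/|G| if and only if either G is isomorphic to the quaternion group Q₈, or G is isomorphic to ℤ/p × ℤ/p with p ∈ {2, 3, 5, 7}. -/
noncomputable def sigma1 (G : Type*) [Group G] : ℚ :=
  (∑ᶠ H : Subgroup G, (Nat.card H : ℚ)) / Nat.card G

/-- The subgroups of order `m` of a finite group. -/
noncomputable def subgroupsOfCard (G : Type*) [Group G] [Finite G] (m : ℕ) :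
    Finset (Subgroup G) :=
  (Set.toFinite {H : Subgroup G | Nat.card H = m}).toFinset

section

variable {G : Type*} [Group G] [Finite G]

@[simp]
theorem mem_subgroupsOfCard {m : ℕ} {H : Subgroup G} :
    H ∈ subgroupsOfCard G m ↔ Nat.card H = m := by
  simp [subgroupsOfCard]

theorem sum_card_subgroup_eq {p n : ℕ} (hp : p.Prime) (hcard : Nat.card G = p ^ n) :
    ∑ᶠ H : Subgroup G, (Nat.card H : ℚ) =
      ((∑ k ∈ Finset.range (n + 1), (subgroupsOfCard G (p ^ k)).card * p ^ k : ℕ) : ℚ) := by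
  classical
  have := Fintype.ofFinite (Subgroup G)
  rw [finsum_eq_sum_of_fintype, ← Nat.cast_sum, Nat.cast_inj,
    ← Nat.sum_divisors_prime_pow (f := fun m => (subgroupsOfCard G m).card * m) hp,
    ← Finset.sum_fiberwise_of_maps_to (t := (p ^ n).divisors)
      (g := fun H : Subgroup G => Nat.card H)]
  · refine Finset.sum_congr rfl fun m _ => ?_
    rw [Finset.sum_const_nat (m := m) (fun H hH => (Finset.mem_filter.1 hH).2)]
    congr 2
    ext H
    simp
  · intro H _
    rw [Nat.mem_divisors, ← hcard]
    exact ⟨H.card_subgroup_dvd_card, Nat.card_pos.ne'⟩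

theorem sigma1_lt_iff {p n : ℕ} (hp : p.Prime) (hcard : Nat.card G = p ^ n) :
    sigma1 G < 2 + 11 / (Nat.card G : ℚ) ↔
      ∑ k ∈ Finset.range (n + 1), (subgroupsOfCard G (p ^ k)).card * p ^ k < 2 * p ^ n + 11 := by
  have h : (0 : ℚ) < Nat.card G := by exact_mod_cast Nat.card_pos
  have h2 : 2 + 11 / (Nat.card G : ℚ) = (2 * Nat.card G + 11) / Nat.card G := by field_simp
  rw [sigma1, h2, div_lt_div_iff_of_pos_right h, sum_card_subgroup_eq hp hcard, hcard]
  norm_cast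

theorem card_subgroupsOfCard_pos {p n k : ℕ} (hp : p.Prime) (hcard : Nat.card G = p ^ n)
    (hk : k ≤ n) : 0 < (subgroupsOfCard G (p ^ k)).card := by
  have := Fact.mk hp
  obtain ⟨H, hH⟩ := Sylow.exists_subgroup_card_pow_prime (G := G) p (n := k)
    (hcard ▸ pow_dvd_pow p hk)
  exact Finset.card_pos.2 ⟨H, mem_subgroupsOfCard.2 hH⟩

theorem card_subgroupsOfCard_one : (subgroupsOfCard G 1).card = 1 := by
  rw [Finset.card_eq_one]
  exact ⟨⊥, by ext H; simp⟩

theorem card_subgroupsOfCard_card : (subgroupsOfCard G (Nat.card G)).card = 1 := by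
  rw [Finset.card_eq_one]
  exact ⟨⊤, by ext H; simp [Subgroup.card_eq_iff_eq_top]⟩

/-- If the subgroups of order `m` cover the group, there are many of them. -/
theorem card_sub_one_le_of_cover {m : ℕ} (h : ∀ x : G, ∃ H : Subgroup G, Nat.card H = m ∧ x ∈ H) :
    Nat.card G - 1 ≤ (subgroupsOfCard G m).card * (m - 1) := by
  classical
  have := Fintype.ofFinite G
  let f : Subgroup G → Finset G := fun H => {x | x ∈ H ∧ x ≠ 1}
  have hf (H : Subgroup G) (hH : H ∈ subgroupsOfCard G m) : (f H).card ≤ m - 1 := by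
    have h1 : f H = ({x | x ∈ H} : Finset G).erase 1 := by
      ext x; simp [f, and_comm]
    rw [h1, Finset.card_erase_of_mem (by simp [H.one_mem]), ← mem_subgroupsOfCard.1 hH,
      Nat.card_eq_fintype_card, Fintype.card_subtype]
  refine le_trans ?_ (Finset.card_biUnion_le_card_mul _ f _ hf)
  rw [Nat.card_eq_fintype_card, ← Finset.card_univ, ← Finset.card_erase_of_mem (Finset.mem_univ 1)]
  refine Finset.card_le_card fun x hx => ?_
  obtain ⟨H, hH, hx'⟩ := h x
  exact Finset.mem_biUnion.2 ⟨H, mem_subgroupsOfCard.2 hH, by simpa [f, hx'] using hx⟩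

/-- If the subgroups of order `m` all contain `Z` and are pairwise disjoint outside `Z`,
there are few of them. -/
theorem card_mul_le_of_disjoint {m : ℕ} (Z : Finset G)
    (hZ : ∀ H : Subgroup G, Nat.card H = m → ∀ z ∈ Z, z ∈ H)
    (h : ∀ x ∉ Z, ∀ H K : Subgroup G, Nat.card H = m → Nat.card K = m → x ∈ H → x ∈ K → H = K) :
    (subgroupsOfCard G m).card * (m - Z.card) ≤ Nat.card G - Z.card := by
  classical
  have := Fintype.ofFinite G
  let f : Subgroup G → Finset G := fun H => ({x | x ∈ H} : Finset G) \ Z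
  have hf (H : Subgroup G) (hH : H ∈ subgroupsOfCard G m) : (f H).card = m - Z.card := by
    rw [mem_subgroupsOfCard] at hH
    rw [Finset.card_sdiff_of_subset (fun z hz => by simpa using hZ H hH z hz), ← hH,
      Nat.card_eq_fintype_card, Fintype.card_subtype]
  rw [← Finset.sum_const_nat hf, ← Finset.card_biUnion, Nat.card_eq_fintype_card,
    ← Finset.card_univ, ← Finset.card_sdiff_of_subset (Finset.subset_univ Z)]
  · refine Finset.card_le_card fun x hx => ?_
    obtain ⟨H, _, hx⟩ := Finset.mem_biUnion.1 hx
    simpa using (Finset.mem_sdiff.1 hx).2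
  · intro H hH K hK hne
    refine Finset.disjoint_left.2 fun x hx hx' => hne ?_
    simp only [f, Finset.mem_sdiff, Finset.mem_filter, Finset.mem_univ, true_and] at hx hx'
    exact h x hx.2 H K (mem_subgroupsOfCard.1 hH) (mem_subgroupsOfCard.1 hK) hx.1 hx'.1

/-- A non-cyclic group of prime power order has more than `p` subgroups of index `p`. -/
theorem lt_card_subgroupsOfCard_of_not_isCyclic {p n : ℕ} (hp : p.Prime)
    (hcard : Nat.card G = p ^ (n + 1)) (hnc : ¬IsCyclic G) :
    p < (subgroupsOfCard G (p ^ n)).card := by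
  have := Fact.mk hp
  have hle := card_sub_one_le_of_cover (G := G) (m := p ^ n) fun x => by
    obtain ⟨k, hk, hx⟩ := (Nat.dvd_prime_pow hp).1
      (hcard ▸ (Subgroup.zpowers x).card_subgroup_dvd_card)
    have hkn : k ≠ n + 1 := by
      rintro rfl
      refine hnc ⟨x, fun y => ?_⟩
      change y ∈ Subgroup.zpowers x
      rw [(Subgroup.card_eq_iff_eq_top _).1 (hx.trans hcard.symm)]
      trivial
    obtain ⟨K, hK, hle⟩ := Sylow.exists_subgroup_card_pow_prime_le p (n := k) (m := n)
      (hcard ▸ pow_dvd_pow p n.le_succ) (Subgroup.zpowers x) hx (by omega)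
    exact ⟨K, hK, hle (Subgroup.mem_zpowers x)⟩
  by_contra! hc
  have h1 : 0 < p ^ n := pow_pos hp.pos n
  have h2 := hp.two_le
  have h3 := hle.trans (Nat.mul_le_mul_right _ hc)
  rw [hcard, pow_succ', Nat.mul_sub_one] at h3
  have h4 : p ≤ p * p ^ n := Nat.le_mul_of_pos_right _ h1
  omega

theorem card_subgroupsOfCard_prime_le {p : ℕ} (hp : p.Prime) (hcard : Nat.card G = p ^ 2) :
    (subgroupsOfCard G p).card ≤ p + 1 := by
  have h := card_mul_le_of_disjoint (G := G) (m := p) {1}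
    (fun H _ z hz => by rw [Finset.mem_singleton.1 hz]; exact H.one_mem) ?_
  · rw [Finset.card_singleton, hcard] at h
    have h2 : p ^ 2 - 1 = (p + 1) * (p - 1) := by
      simpa using Nat.sq_sub_sq p 1
    rw [h2] at h
    exact Nat.le_of_mul_le_mul_right h (by have := hp.two_le; omega)
  · intro x hx H K hH hK hxH hxK
    have hx1 : x ≠ 1 := by simpa using hx
    have key (L : Subgroup G) (hL : Nat.card L = p) (hxL : x ∈ L) : L = Subgroup.zpowers x := by
      refine (Subgroup.eq_of_le_of_card_ge (Subgroup.zpowers_le.2 hxL) ?_).symm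
      have hd : orderOf x ∣ p := by
        rw [← hL, ← Nat.card_zpowers]
        exact Subgroup.card_dvd_of_le (Subgroup.zpowers_le.2 hxL)
      rw [hL, Nat.card_zpowers]
      rcases (Nat.dvd_prime hp).1 hd with h | h
      · exact absurd (orderOf_eq_one_iff.1 h) hx1
      · exact h.ge
    rw [key H hH hxH, key K hK hxK]

theorem nonempty_linearEquiv_of_card_prime_sq {p : ℕ} [Fact p.Prime] {A : Type*} [AddCommGroup A]
    [Module (ZMod p) A] [Finite A] (hcard : Nat.card A = p ^ 2) :
    Nonempty (A ≃ₗ[ZMod p] ZMod p × ZMod p) := by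
  have hrank : Module.finrank (ZMod p) A = 2 := by
    have h := Module.natCard_eq_pow_finrank (K := ZMod p) (V := A)
    rw [Nat.card_zmod] at h
    exact Nat.pow_right_injective (Fact.out : p.Prime).two_le (h.symm.trans hcard)
  exact FiniteDimensional.nonempty_linearEquiv_of_finrank_eq (by simp [hrank])

theorem nonempty_mulEquiv_of_card_prime_sq_of_pow {G : Type*} [CommGroup G] [Finite G] {p : ℕ}
    (hp : p.Prime) (hcard : Nat.card G = p ^ 2) (hexp : ∀ x : G, x ^ p = 1) :
    Nonempty (G ≃* Multiplicative (ZMod p) × Multiplicative (ZMod p)) := by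
  have := Fact.mk hp
  let : Module (ZMod p) (Additive G) := AddCommGroup.zmodModule fun x => hexp x.toMul
  obtain ⟨e⟩ := nonempty_linearEquiv_of_card_prime_sq (A := Additive G) (p := p) hcard
  let e' : Additive G ≃+ ZMod p × ZMod p := e.toAddEquiv
  exact ⟨{ toFun := fun x => (.ofAdd (e' (.ofMul x)).1, .ofAdd (e' (.ofMul x)).2)
           invFun := fun y => (e'.symm (y.1.toAdd, y.2.toAdd)).toMul
           left_inv := fun x => by simp
           right_inv := fun y => by simp
           map_mul' := fun x y => by simp }⟩

/-- A non-cyclic group of order `p ^ 2` is elementary abelian. -/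
theorem nonempty_mulEquiv_of_card_prime_sq {p : ℕ} (hp : p.Prime) (hcard : Nat.card G = p ^ 2)
    (hnc : ¬IsCyclic G) : Nonempty (G ≃* Multiplicative (ZMod p) × Multiplicative (ZMod p)) := by
  have := Fact.mk hp
  refine @nonempty_mulEquiv_of_card_prime_sq_of_pow G
    (IsPGroup.commGroupOfCardEqPrimeSq hcard) _ p hp hcard fun x => ?_
  change x ^ p = 1
  rw [← orderOf_dvd_iff_pow_eq_one]
  obtain ⟨k, hk, hx⟩ := (Nat.dvd_prime_pow hp).1 (hcard ▸ orderOf_dvd_natCard x)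
  have hk2 : k ≠ 2 := by
    rintro rfl
    exact hnc (isCyclic_of_orderOf_eq_card x (hx.trans hcard.symm))
  rw [hx]
  exact (pow_dvd_pow p (show k ≤ 1 by omega)).trans (pow_one p).dvd

/-- In a non-cyclic group of order 8 with a unique involution `z`, every element
other than `1` and `z` squares to `z`. -/
theorem sq_eq_of_unique_involution (hcard : Nat.card G = 8) (hnc : ¬IsCyclic G) {z : G}
    (hu : ∀ x : G, x ^ 2 = 1 → x = 1 ∨ x = z) {x : G} (hx1 : x ≠ 1) (hxz : x ≠ z) :
    x ^ 2 = z := by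
  have h4 : x ^ 4 = 1 := by
    rw [← orderOf_dvd_iff_pow_eq_one]
    have h8 : orderOf x ≠ 8 := fun h => hnc (isCyclic_of_orderOf_eq_card x (h.trans hcard.symm))
    obtain ⟨k, hk, hx⟩ := (Nat.dvd_prime_pow (m := 3) Nat.prime_two).1
      (hcard ▸ orderOf_dvd_natCard x)
    have hk3 : k ≠ 3 := by
      rintro rfl
      exact h8 hx
    rw [hx]
    exact pow_dvd_pow 2 (show k ≤ 2 by omega)
  refine (hu (x ^ 2) (by rw [← pow_mul, h4])).resolve_left fun h => ?_
  exact (hu x h).elim hx1 hxz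

/-- Elements `i` of order 4 and `j` outside the powers of `i` satisfying the quaternion relations
define an embedding of the quaternion group. -/
theorem exists_injective_quaternionGroup_two {G : Type*} [Group G] {i j : G}
    (hi : orderOf i = 4) (hj : j ^ 2 = i ^ 2) (hij : i * j = j * i⁻¹)
    (hmem : j ∉ Subgroup.zpowers i) :
    ∃ f : QuaternionGroup 2 →* G, Function.Injective f := by
  let φ : ZMod 4 → G := fun k => i ^ k.val
  have hφ (k l : ZMod 4) : φ (k + l) = φ k * φ l := by
    simp only [φ, ZMod.val_add, ← pow_add]
    exact pow_eq_pow_iff_modEq.2 (by rw [hi]; exact Nat.mod_modEq _ _)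
  have hφ0 : φ 0 = 1 := by simp [φ]
  have hφneg (k : ZMod 4) : φ (-k) = (φ k)⁻¹ := by
    rw [eq_inv_iff_mul_eq_one, ← hφ, neg_add_cancel, hφ0]
  have hφ2 : φ 2 = j ^ 2 := hj.symm
  have hcomm (k : ZMod 4) : φ k * j = j * φ (-k) := by
    have h : SemiconjBy j i⁻¹ i := hij.symm
    have := h.pow_right k.val
    rw [hφneg]
    simpa [φ, SemiconjBy, eq_comm] using this
  have hmem' (k : ZMod 4) : φ k ∈ Subgroup.zpowers i :=
    (Subgroup.zpowers i).pow_mem (Subgroup.mem_zpowers i) _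
  let F : QuaternionGroup 2 → G
    | .a k => φ k
    | .xa k => j * φ k
  let f : QuaternionGroup 2 →* G :=
    { toFun := F
      map_one' := hφ0
      map_mul' := by
        rintro (k | k) (l | l)
        · exact hφ k l
        · change j * φ (l - k) = φ k * (j * φ l)
          rw [← mul_assoc, hcomm, mul_assoc, ← hφ, neg_add_eq_sub]
        · change j * φ (k + l) = j * φ k * φ l
          rw [hφ, mul_assoc]
        · change φ (2 + l - k) = j * φ k * (j * φ l)
          rw [← mul_assoc, mul_assoc j, hcomm, ← mul_assoc, mul_assoc, ← hφ (-k), ← sq j, ← hφ2]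
          exact (congrArg φ (by ring)).trans (hφ 2 (-k + l)) }
  refine ⟨f, (injective_iff_map_eq_one f).2 ?_⟩
  rintro (k | k) hk
  · change i ^ k.val = 1 at hk
    have hdvd := hi ▸ orderOf_dvd_of_pow_eq_one hk
    have h0 := Nat.eq_zero_of_dvd_of_lt hdvd (ZMod.val_lt (n := 4) k)
    rw [(ZMod.val_eq_zero (n := 4) k).1 h0]
    rfl
  · change j * φ k = 1 at hk
    rw [mul_eq_one_iff_eq_inv] at hk
    exact absurd (hk ▸ (Subgroup.zpowers i).inv_mem (hmem' k)) hmem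

/-- A non-cyclic group of order 8 with a unique involution is the quaternion group. -/
theorem nonempty_mulEquiv_quaternionGroup_two (hcard : Nat.card G = 8) (hnc : ¬IsCyclic G) {z : G}
    (hz : orderOf z = 2) (hu : ∀ x : G, x ^ 2 = 1 → x = 1 ∨ x = z) :
    Nonempty (G ≃* QuaternionGroup 2) := by
  have hsq {x : G} (hx1 : x ≠ 1) (hxz : x ≠ z) : x ^ 2 = z :=
    sq_eq_of_unique_involution hcard hnc hu hx1 hxz
  have hz1 : z ≠ 1 := by
    rintro rfl
    simp at hz
  have hout {K : Subgroup G} (hK : Nat.card K < 8) : ∃ x, x ∉ K := by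
    by_contra! h
    rw [(Subgroup.eq_top_iff' K).2 h, Subgroup.card_top] at hK
    omega
  obtain ⟨i, hi⟩ := hout (K := Subgroup.zpowers z) (by rw [Nat.card_zpowers]; omega)
  have hi1 : i ≠ 1 := by
    rintro rfl
    exact hi (Subgroup.one_mem _)
  have hi2 : i ^ 2 = z := hsq hi1 (by rintro rfl; exact hi (Subgroup.mem_zpowers _))
  have hi4 : orderOf i = 4 := by
    refine orderOf_eq_prime_pow (p := 2) (n := 1) (by simpa [hi2]) ?_
    rw [show 2 ^ (1 + 1) = 2 * 2 from rfl, pow_mul, hi2, ← hz, pow_orderOf_eq_one]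
  obtain ⟨j, hj⟩ := hout (K := Subgroup.zpowers i) (by rw [Nat.card_zpowers]; omega)
  have hzi : z ∈ Subgroup.zpowers i := hi2 ▸ Subgroup.pow_mem _ (Subgroup.mem_zpowers i) 2
  have hne {x : G} (hx : x ∉ Subgroup.zpowers i) : x ^ 2 = z :=
    hsq (by rintro rfl; exact hx (Subgroup.one_mem _)) (by rintro rfl; exact hx hzi)
  have hj2 : j ^ 2 = i ^ 2 := (hne hj).trans hi2.symm
  have hij2 : (i * j) ^ 2 = i ^ 2 := by
    rw [hne, hi2]
    rwa [Subgroup.mul_mem_cancel_left _ (Subgroup.mem_zpowers i)]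
  have hij : i * j = j * i⁻¹ := by
    have h1 : j * i * j = i := by
      rw [sq, sq, mul_assoc, mul_right_inj, ← mul_assoc] at hij2
      exact hij2
    have h2 : i * j * j = j * i⁻¹ * j := by
      have h3 : i * j * j = i * i * i := by rw [mul_assoc, ← sq, hj2, sq, mul_assoc]
      have h4 : i⁻¹ = i * j ^ 2 := by
        rw [inv_eq_iff_mul_eq_one, hj2, ← pow_succ', ← pow_succ']
        exact orderOf_dvd_iff_pow_eq_one.1 hi4.dvd
      rw [h3, h4, sq, ← mul_assoc, ← mul_assoc, h1, mul_assoc, mul_assoc, ← sq j, hj2, sq]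
    exact mul_right_cancel h2
  obtain ⟨f, hf⟩ := exists_injective_quaternionGroup_two hi4 hj2 hij hj
  have hbij : Function.Bijective f := (Nat.bijective_iff_injective_and_card f).2
    ⟨hf, by rw [hcard, Nat.card_eq_fintype_card, QuaternionGroup.card]⟩
  exact ⟨(MulEquiv.ofBijective f hbij).symm⟩

/-- A non-cyclic group of order 8 other than the quaternion group has at least three subgroups
of order 2. -/
theorem three_le_card_subgroupsOfCard_two (hcard : Nat.card G = 8) (hnc : ¬IsCyclic G)
    (hq : ¬Nonempty (G ≃* QuaternionGroup 2)) : 3 ≤ (subgroupsOfCard G 2).card := by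
  classical
  obtain ⟨s, hs⟩ := exists_prime_orderOf_dvd_card' (G := G) 2 (by rw [hcard]; norm_num)
  have hs2 : s * s = 1 := by rw [← sq, ← hs, pow_orderOf_eq_one]
  have hs1 : s ≠ 1 := by
    rintro rfl
    simp at hs
  have ht : ∃ t : G, t * t = 1 ∧ t ≠ 1 ∧ t ≠ s := by
    by_contra! h
    refine hq (nonempty_mulEquiv_quaternionGroup_two hcard hnc hs fun x hx => ?_)
    by_cases hx1 : x = 1
    · exact .inl hx1
    · exact .inr (h x (by rwa [← sq]) hx1)
  obtain ⟨t, ht2, ht1, hts⟩ := ht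
  have hu : ∃ u : G, u * u = 1 ∧ u ≠ 1 ∧ u ≠ s ∧ u ≠ t := by
    by_cases hc : s * t = t * s
    · refine ⟨s * t, ?_, ?_, by simpa, by simpa⟩
      · rw [mul_assoc, hc, ← mul_assoc t, ht2, one_mul, hs2]
      · intro h
        exact hts (mul_left_cancel (h.trans hs2.symm))
    · refine ⟨s * t * s, ?_, ?_, ?_, ?_⟩
      · rw [mul_assoc, ← mul_assoc s (s * t), ← mul_assoc s s, hs2, one_mul, mul_assoc,
          ← mul_assoc t, ht2, one_mul, hs2]
      · intro h
        rw [mul_eq_one_iff_eq_inv, ← mul_eq_one_iff_eq_inv.1 hs2, mul_eq_left] at h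
        exact ht1 h
      · intro h
        rw [mul_eq_right] at h
        exact hts (mul_left_cancel (h.trans hs2.symm))
      · intro h
        refine hc (mul_right_cancel (b := s) ?_)
        rw [h, mul_assoc, hs2, mul_one]
  obtain ⟨u, hu2, hu1, hus, hut⟩ := hu
  have hcard2 {x : G} (hx : x * x = 1) (hx1 : x ≠ 1) : Nat.card (Subgroup.zpowers x) = 2 := by
    rw [Nat.card_zpowers]
    exact orderOf_eq_prime (by rw [sq, hx]) hx1
  have hinj {x y : G} (hx : x * x = 1) (hy : y * y = 1) (hy1 : y ≠ 1) (hxy : x ≠ y) :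
      Subgroup.zpowers x ≠ Subgroup.zpowers y := by
    intro h
    have hy' : y ∈ Subgroup.zpowers x := h ▸ Subgroup.mem_zpowers y
    obtain ⟨k, rfl⟩ := Subgroup.mem_zpowers_iff.1 hy'
    rcases Int.even_or_odd' k with ⟨m, rfl | rfl⟩
    · exact hy1 (by rw [zpow_mul, zpow_ofNat, sq, hx, one_zpow])
    · exact hxy (by rw [zpow_add_one, zpow_mul, zpow_ofNat, sq, hx, one_zpow, one_mul])
  rw [← Finset.card_eq_three.2 ⟨_, _, _, hinj hs2 ht2 ht1 hts.symm, hinj hs2 hu2 hu1 hus.symm,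
    hinj ht2 hu2 hu1 hut.symm, rfl⟩]
  refine Finset.card_le_card fun H hH => mem_subgroupsOfCard.2 ?_
  simp only [Finset.mem_insert, Finset.mem_singleton] at hH
  rcases hH with rfl | rfl | rfl
  exacts [hcard2 hs2 hs1, hcard2 ht2 ht1, hcard2 hu2 hu1]

theorem card_subgroupsOfCard_two_four_le (hcard : Nat.card G = 8) (hnc : ¬IsCyclic G) {z : G}
    (hz : orderOf z = 2) (hu : ∀ x : G, x ^ 2 = 1 → x = 1 ∨ x = z) :
    (subgroupsOfCard G 2).card ≤ 1 ∧ (subgroupsOfCard G 4).card ≤ 3 := by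
  classical
  have hz1 : z ≠ 1 := by
    rintro rfl
    simp at hz
  have hmem (H : Subgroup G) (hH : 2 ∣ Nat.card H) : z ∈ H := by
    obtain ⟨x, hx⟩ := exists_prime_orderOf_dvd_card' (G := H) 2 hH
    rw [← Subgroup.orderOf_coe] at hx
    have hx2 : (x : G) ^ 2 = 1 := by rw [← hx, pow_orderOf_eq_one]
    rcases hu x hx2 with h | h
    · simp [h] at hx
    · exact h ▸ x.2
  constructor
  · refine Finset.card_le_one.2 fun H hH K hK => ?_
    rw [mem_subgroupsOfCard] at hH hK
    have key (L : Subgroup G) (hL : Nat.card L = 2) : Subgroup.zpowers z = L :=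
      Subgroup.eq_of_le_of_card_ge (Subgroup.zpowers_le.2 (hmem L hL.symm.dvd))
        (by rw [hL, Nat.card_zpowers, hz])
    rw [← key H hH, ← key K hK]
  · have h := card_mul_le_of_disjoint (G := G) (m := 4) {1, z} ?_ ?_
    · rw [Finset.card_pair hz1.symm, hcard] at h
      omega
    · intro H hH x hx
      simp only [Finset.mem_insert, Finset.mem_singleton] at hx
      rcases hx with rfl | rfl
      · exact H.one_mem
      · exact hmem H (by rw [hH]; norm_num)
    · intro x hx H K hH hK hxH hxK
      simp only [Finset.mem_insert, Finset.mem_singleton, not_or] at hx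
      have hx2 := sq_eq_of_unique_involution hcard hnc hu hx.1 hx.2
      have hx4 : orderOf x = 4 := by
        refine orderOf_eq_prime_pow (p := 2) (n := 1) (by simpa [hx2]) ?_
        rw [show 2 ^ (1 + 1) = 2 * 2 from rfl, pow_mul, hx2, ← hz, pow_orderOf_eq_one]
      have key (L : Subgroup G) (hL : Nat.card L = 4) (hxL : x ∈ L) : Subgroup.zpowers x = L :=
        Subgroup.eq_of_le_of_card_ge (Subgroup.zpowers_le.2 hxL)
          (by rw [hL, Nat.card_zpowers, hx4])
      rw [← key H hH hxH, ← key K hK hxK]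

theorem exists_unique_involution_of_mulEquiv {G : Type*} [Group G] (e : G ≃* QuaternionGroup 2) :
    ∃ z : G, orderOf z = 2 ∧ ∀ x : G, x ^ 2 = 1 → x = 1 ∨ x = z := by
  have hq : ∀ y : QuaternionGroup 2, y * y = 1 → y = 1 ∨ y = .a 2 := by decide
  have hz : orderOf (QuaternionGroup.a 2 : QuaternionGroup 2) = 2 :=
    orderOf_eq_prime (by rw [sq]; decide) (by decide)
  refine ⟨e.symm (.a 2), by rw [MulEquiv.orderOf_eq, hz], fun x hx => ?_⟩
  rw [MulEquiv.eq_symm_apply, ← map_eq_one_iff e e.injective]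
  exact hq _ (by rw [← map_mul, ← sq, hx, map_one])

end

theorem stmt_6 (p : ℕ) (hp : p.Prime) (n : ℕ) (hn : 1 ≤ n)
    (G : Type*) [Group G] [Finite G] (hcard : Nat.card G = p ^ n)
    (hnc : ¬IsCyclic G) :
    sigma1 G < 2 + 11 / (Nat.card G : ℚ) ↔
      Nonempty (G ≃* QuaternionGroup 2) ∨
        ((p = 2 ∨ p = 3 ∨ p = 5 ∨ p = 7) ∧
          Nonempty (G ≃* Multiplicative (ZMod p) × Multiplicative (ZMod p))) := by
  have := Fact.mk hp
  have hp2 := hp.two_le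
  have hbot : (subgroupsOfCard G (p ^ 0)).card = 1 := by rw [pow_zero, card_subgroupsOfCard_one]
  have htop : (subgroupsOfCard G (p ^ n)).card = 1 := by rw [← hcard, card_subgroupsOfCard_card]
  have hn1 : n ≠ 1 := by
    rintro rfl
    exact hnc (isCyclic_of_prime_card (hcard.trans (pow_one p)))
  rw [sigma1_lt_iff hp hcard]
  constructor
  · intro hlt
    obtain rfl | ⟨m, rfl⟩ : n = 2 ∨ ∃ m, n = m + 3 := by
      rcases lt_trichotomy n 2 with h | h | h
      · omega
      · exact .inl h
      · exact .inr ⟨n - 3, by omega⟩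
    · refine .inr ⟨?_, nonempty_mulEquiv_of_card_prime_sq hp hcard hnc⟩
      have hmax := lt_card_subgroupsOfCard_of_not_isCyclic (n := 1) hp hcard hnc
      simp only [Finset.sum_range_succ, Finset.sum_range_zero, hbot, htop] at hlt
      have hp10 : p < 10 := by nlinarith
      interval_cases p <;> first | omega | (exact absurd hp (by norm_num))
    · have hmax := lt_card_subgroupsOfCard_of_not_isCyclic (n := m + 2) hp hcard hnc
      have hmid := card_subgroupsOfCard_pos (k := m + 1) hp hcard (by omega)
      have hlow : 1 ≤ ∑ k ∈ Finset.range (m + 1), (subgroupsOfCard G (p ^ k)).card * p ^ k := by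
        rw [Finset.sum_range_succ', hbot]
        simp
      simp only [Finset.sum_range_succ _ (m + 3), Finset.sum_range_succ _ (m + 2),
        Finset.sum_range_succ _ (m + 1), htop] at hlt
      have h1 : (p + 1) * p ^ (m + 2) ≤ (subgroupsOfCard G (p ^ (m + 2))).card * p ^ (m + 2) :=
        Nat.mul_le_mul_right _ hmax
      have h2 : p ^ (m + 3) = p * p ^ (m + 2) := pow_succ' p (m + 2)
      have h3 : p ^ (m + 2) = p * p ^ (m + 1) := pow_succ' p (m + 1)
      have h4 : p ^ (m + 1) ≤ (subgroupsOfCard G (p ^ (m + 1))).card * p ^ (m + 1) :=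
        Nat.le_mul_of_pos_left _ hmid
      have h5 : p ^ (m + 2) + p ^ (m + 1) < 10 := by
        rw [add_one_mul, ← h2] at h1
        omega
      have h6 : p ^ (m + 1) < 4 := by nlinarith
      have hpm : p ≤ p ^ (m + 1) := Nat.le_self_pow m.succ_ne_zero p
      have hp_eq : p = 2 := by
        by_contra hne
        have : 3 ≤ p := by omega
        nlinarith
      subst hp_eq
      have hm : m = 0 := by
        by_contra hne
        have := Nat.pow_le_pow_right (n := 2) (by norm_num) (show 2 ≤ m + 1 by omega)
        omega
      subst hm
      by_contra! hq
      have h7 := three_le_card_subgroupsOfCard_two hcard hnc (by simpa using hq.1)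
      rw [Finset.sum_range_succ, Finset.sum_range_zero, hbot] at hlt
      norm_num at hlt hmax h7
      omega
  · rintro (⟨⟨e⟩⟩ | ⟨hp7, ⟨e⟩⟩)
    · have hcard8 : Nat.card G = 8 := by
        rw [Nat.card_congr e.toEquiv, Nat.card_eq_fintype_card, QuaternionGroup.card]
      have hp_eq : p = 2 := by
        have h : p ∣ 2 ^ 3 := by
          rw [show 2 ^ 3 = p ^ n from hcard8.symm.trans hcard]
          exact dvd_pow_self p (by omega)
        exact (Nat.prime_dvd_prime_iff_eq hp Nat.prime_two).1 (hp.dvd_of_dvd_pow h)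
      subst hp_eq
      have hn3 : n = 3 := Nat.pow_right_injective le_rfl (hcard.symm.trans hcard8)
      subst hn3
      obtain ⟨z, hz, hu⟩ := exists_unique_involution_of_mulEquiv e
      obtain ⟨h2, h4⟩ := card_subgroupsOfCard_two_four_le hcard8 hnc hz hu
      simp only [Finset.sum_range_succ, Finset.sum_range_zero, hbot, htop]
      norm_num
      omega
    · have hcard2 : Nat.card G = p ^ 2 := by
        rw [Nat.card_congr e.toEquiv, Nat.card_prod, Nat.card_congr Multiplicative.toAdd,
          Nat.card_zmod, sq]
      have hn2 : n = 2 := Nat.pow_right_injective hp2 (hcard.symm.trans hcard2)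
      subst hn2
      have hle := card_subgroupsOfCard_prime_le hp hcard
      simp only [Finset.sum_range_succ, Finset.sum_range_zero, hbot, htop, pow_one]
      rcases hp7 with rfl | rfl | rfl | rfl <;> norm_num <;> omega
end

section
/- Let G be a finite group that is not nilpotent and satisfies σ₁(G) < 3. Then all non-normal maximal subgroups of G are conjugate to each other (i.e., G has exactly one conjugacy class of non-normal maximal subgroups), and every non-normal maximal subgroup of G is cyclic. -/
open scoped Pointwise

/-- The number of conjugates of a non-normal maximal subgroup is its index. -/
theorem ncard_conjugates_of_isCoatom {G : Type*} [Group G] {M : Subgroup G}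
    (hM : IsCoatom M) (hn : ¬M.Normal) :
    (Set.range fun g : G => MulAut.conj g • M).ncard = M.index := by
  let : MulAction G (Subgroup G) := MulAction.compHom _ (MulAut.conj : G →* MulAut G)
  have hle : M ≤ MulAction.stabilizer G M := fun g hg =>
    Subgroup.conj_smul_eq_self_of_mem hg
  have hne : MulAction.stabilizer G M ≠ ⊤ := by
    intro htop
    refine hn ⟨fun x hx g => ?_⟩
    have hg : MulAut.conj g • M = M := by
      have : g ∈ MulAction.stabilizer G M := htop ▸ Subgroup.mem_top g
      exact this
    rw [← hg]
    exact Subgroup.smul_mem_pointwise_smul x (MulAut.conj g) M hx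
  have heq : MulAction.stabilizer G M = M :=
    (hM.le_iff.mp hle).resolve_left hne
  have := MulAction.index_stabilizer G M
  rw [heq] at this
  exact this.symm

/-- The orders of the conjugates of a non-normal maximal subgroup add up to the group order. -/
theorem sum_card_conjugates_of_isCoatom {G : Type*} [Group G] [Finite G] {M : Subgroup G}
    (hM : IsCoatom M) (hn : ¬M.Normal) :
    ∑ᶠ H ∈ Set.range fun g : G => MulAut.conj g • M, Nat.card H = Nat.card G := by
  have hc : ∀ H ∈ Set.range (fun g : G => MulAut.conj g • M), Nat.card H = Nat.card M := by
    rintro _ ⟨g, rfl⟩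
    exact (Nat.card_congr (Subgroup.equivSMul (MulAut.conj g) M).toEquiv).symm
  rw [finsum_mem_congr rfl hc, finsum_mem_eq_finite_toFinset_sum _ (Set.toFinite _),
    Finset.sum_const, ← Set.ncard_eq_toFinset_card, ncard_conjugates_of_isCoatom hM hn,
    smul_eq_mul, Subgroup.index_mul_card]

/-- The orders of the cyclic subgroups add up to at least the group order. -/
theorem card_le_sum_card_isCyclic (G : Type*) [Group G] [Finite G] :
    Nat.card G ≤ ∑ᶠ H ∈ {H : Subgroup G | IsCyclic H}, Nat.card H := by
  classical
  have := Fintype.ofFinite G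
  rw [finsum_mem_eq_finite_toFinset_sum _ (Set.toFinite _), Nat.card_eq_fintype_card,
    ← Finset.card_univ]
  have hsub : (Finset.univ : Finset G) ⊆
      (Set.toFinite {H : Subgroup G | IsCyclic H}).toFinset.biUnion
        fun H => (H : Set G).toFinset := by
    intro g _
    simp only [Finset.mem_biUnion, Set.Finite.mem_toFinset, Set.mem_ofPred_eq, Set.mem_toFinset]
    exact ⟨Subgroup.zpowers g, inferInstance, Subgroup.mem_zpowers g⟩
  refine (Finset.card_le_card hsub).trans (Finset.card_biUnion_le.trans
    (Finset.sum_le_sum fun H _ => ?_))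
  rw [Set.toFinset_card, ← Nat.card_eq_fintype_card]
  exact le_rfl

/-- Two disjoint families of proper subgroups, each of total order at least `|G|`, force
`σ₁(G) ≥ 3`. -/
theorem three_le_sigma1_of_disjoint {G : Type*} [Group G] [Finite G] {S T : Set (Subgroup G)}
    (hST : Disjoint S T) (hS : ⊤ ∉ S) (hT : ⊤ ∉ T)
    (hSc : Nat.card G ≤ ∑ᶠ H ∈ S, Nat.card H) (hTc : Nat.card G ≤ ∑ᶠ H ∈ T, Nat.card H) :
    3 ≤ sigma1 G := by
  classical
  have := Fintype.ofFinite (Subgroup G)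
  rw [finsum_mem_eq_finite_toFinset_sum _ (Set.toFinite _)] at hSc hTc
  have hd : Disjoint (Set.toFinite S).toFinset (Set.toFinite T).toFinset := by
    simpa using hST
  have htop : (⊤ : Subgroup G) ∉ (Set.toFinite S).toFinset ∪ (Set.toFinite T).toFinset := by
    simp [hS, hT]
  have hsum : 3 * Nat.card G ≤ ∑ H : Subgroup G, Nat.card H := by
    refine le_trans ?_ (Finset.sum_le_sum_of_subset (Finset.subset_univ
      (insert ⊤ ((Set.toFinite S).toFinset ∪ (Set.toFinite T).toFinset))))
    rw [Finset.sum_insert htop, Finset.sum_union hd, Subgroup.card_top]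
    omega
  rw [sigma1, finsum_eq_sum_of_fintype, le_div_iff₀ (Nat.cast_pos.mpr Nat.card_pos)]
  exact_mod_cast hsum

theorem stmt_8 (G : Type*) [Group G] [Finite G]
    (hnil : ¬Group.IsNilpotent G) (h : sigma1 G < 3) :
    (∃ M : Subgroup G, IsCoatom M ∧ ¬M.Normal) ∧
    (∀ M N : Subgroup G, IsCoatom M → ¬M.Normal → IsCoatom N → ¬N.Normal →
      ∃ g : G, Subgroup.map (MulAut.conj g).toMonoidHom M = N) ∧
    (∀ M : Subgroup G, IsCoatom M → ¬M.Normal → IsCyclic M) := by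
  have htop : ∀ M : Subgroup G, IsCoatom M →
      ⊤ ∉ Set.range fun g : G => MulAut.conj g • M := by
    rintro M hM ⟨g, hg⟩
    refine hM.1 (Subgroup.card_eq_iff_eq_top M |>.mp ?_)
    rw [Nat.card_congr (Subgroup.equivSMul (MulAut.conj g) M).toEquiv]
    exact (congrArg (fun H : Subgroup G => Nat.card H) hg).trans Subgroup.card_top
  refine ⟨?_, fun M N hM hMn hN hNn => ?_, fun M hM hMn => ?_⟩
  · by_contra! hall
    exact hnil ((Group.isNilpotent_of_finite_tfae (G := G)).out 0 2 |>.mpr hall)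
  · by_contra! hconj
    refine h.not_ge (three_le_sigma1_of_disjoint ?_ (htop M hM) (htop N hN)
      (sum_card_conjugates_of_isCoatom hM hMn).ge (sum_card_conjugates_of_isCoatom hN hNn).ge)
    rw [Set.disjoint_left]
    rintro _ ⟨a, rfl⟩ ⟨b, hb⟩
    refine hconj (b⁻¹ * a) ?_
    change MulAut.conj (b⁻¹ * a) • M = N
    rw [map_mul, mul_smul, map_inv, inv_smul_eq_iff]
    exact hb.symm
  · by_contra hcyc
    refine h.not_ge (three_le_sigma1_of_disjoint ?_ (htop M hM) ?_
      (sum_card_conjugates_of_isCoatom hM hMn).ge (card_le_sum_card_isCyclic G))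
    · rw [Set.disjoint_left]
      rintro _ ⟨g, rfl⟩ hg
      exact hcyc ((Subgroup.equivSMul (MulAut.conj g) M).isCyclic.mpr hg)
    · intro hG
      have : IsCyclic G := Subgroup.topEquiv.isCyclic.mp hG
      let := IsCyclic.commGroup (α := G)
      exact hnil inferInstance
end

section
/- Let G be a finite group that is not nilpotent and satisfies σ₁(G) < 3. Then G is solvable, and there exist a prime p and a Sylow p-subgroup P of G such that P is normal in G and G possesses a cyclic subgroup K with |K| = |G|/|P| (a cyclic p-complement), so that G is the semidirect product of P by K. -/
open scoped Pointwise

theorem three_le_sigma1 {G : Type*} [Group G] [Finite G] {A B : Set (Subgroup G)}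
    (hAB : Disjoint A B) (hAtop : ⊤ ∉ A) (hBtop : ⊤ ∉ B)
    (hA : Nat.card G ≤ ∑ᶠ H ∈ A, Nat.card H) (hB : Nat.card G ≤ ∑ᶠ H ∈ B, Nat.card H) :
    3 ≤ sigma1 G := by
  have hsum : 3 * Nat.card G ≤ ∑ᶠ H : Subgroup G, Nat.card H := by
    calc 3 * Nat.card G
        ≤ (∑ᶠ H ∈ A, Nat.card H) + (∑ᶠ H ∈ B, Nat.card H) + Nat.card G := by lia
      _ = ∑ᶠ H ∈ insert ⊤ (A ∪ B), Nat.card H := by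
        rw [finsum_mem_insert _ (by simp [hAtop, hBtop]) (Set.toFinite _),
          finsum_mem_union hAB (Set.toFinite _) (Set.toFinite _), Subgroup.card_top]
        ring
      _ ≤ ∑ᶠ H ∈ (Set.univ : Set (Subgroup G)), Nat.card H := by
        rw [finsum_mem_eq_finite_toFinset_sum _ (Set.toFinite _),
          finsum_mem_eq_finite_toFinset_sum _ (Set.toFinite _)]
        exact Finset.sum_le_sum_of_subset (by simp)
      _ = ∑ᶠ H : Subgroup G, Nat.card H := finsum_mem_univ _
  have := Fintype.ofFinite (Subgroup G)
  have hpos : (0 : ℚ) < Nat.card G := by exact_mod_cast Nat.card_pos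
  rw [sigma1, le_div_iff₀ hpos, finsum_eq_sum_of_fintype]
  rw [finsum_eq_sum_of_fintype] at hsum
  exact_mod_cast hsum

theorem card_eq_of_mem_conj_orbit {G : Type*} [Group G] {H K : Subgroup G}
    (hK : K ∈ MulAction.orbit (ConjAct G) H) : Nat.card K = Nat.card H := by
  obtain ⟨g, rfl⟩ := hK
  exact (Nat.card_congr (Subgroup.equivSMul g H).toEquiv).symm

theorem finsum_card_conj_orbit {G : Type*} [Group G] [Finite G] {H : Subgroup G}
    (hH : Subgroup.normalizer (H : Set G) = H) :
    ∑ᶠ K ∈ MulAction.orbit (ConjAct G) H, Nat.card K = Nat.card G := by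
  have hstab : Nat.card (MulAction.stabilizer (ConjAct G) H) = Nat.card H := by
    refine Nat.card_congr (ConjAct.ofConjAct.toEquiv.subtypeEquiv fun g => ?_)
    rw [MulAction.mem_stabilizer_iff]
    conv_rhs => rw [← hH]
    exact Subgroup.conjAct_pointwise_smul_iff (g := ConjAct.ofConjAct g)
  rw [finsum_mem_congr (t := MulAction.orbit (ConjAct G) H) rfl fun K hK =>
      card_eq_of_mem_conj_orbit hK,
    finsum_mem_eq_finite_toFinset_sum _ (Set.toFinite _), Finset.sum_const, smul_eq_mul,
    ← Set.ncard_eq_toFinset_card _ (Set.toFinite _), ← hstab, ← MulAction.index_stabilizer,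
    Subgroup.index_mul_card]
  rfl

theorem card_le_finsum_card_coatoms {G : Type*} [Group G] [Finite G] {N : Subgroup G} [N.Normal]
    (hN : ¬ IsCyclic (G ⧸ N)) :
    Nat.card G ≤ ∑ᶠ H ∈ {H : Subgroup G | IsCoatom H ∧ N ≤ H}, Nat.card H := by
  have hcover : ∀ x : G, ∃ H : Subgroup G, (IsCoatom H ∧ N ≤ H) ∧ x ∈ H := by
    intro x
    rcases eq_top_or_exists_le_coatom (N ⊔ Subgroup.zpowers x) with h | ⟨H, hH, hle⟩
    · refine absurd ?_ hN
      rw [isCyclic_iff_exists_zpowers_eq_top]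
      refine ⟨QuotientGroup.mk' N x, ?_⟩
      rw [← MonoidHom.map_zpowers, ← Subgroup.map_top_of_surjective _
        (QuotientGroup.mk'_surjective N), ← h, Subgroup.map_sup, QuotientGroup.map_mk'_self,
        bot_sup_eq]
    · exact ⟨H, ⟨hH, le_sup_left.trans hle⟩,
        hle (le_sup_right (a := N) (Subgroup.mem_zpowers x))⟩
  classical
  have := Fintype.ofFinite G
  rw [finsum_mem_eq_finite_toFinset_sum _ (Set.toFinite _)]
  set S := (Set.toFinite {H : Subgroup G | IsCoatom H ∧ N ≤ H}).toFinset
  have huniv : (Finset.univ : Finset G) ⊆ S.biUnion fun H => (H : Set G).toFinset := by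
    intro x _
    obtain ⟨H, hH, hx⟩ := hcover x
    exact Finset.mem_biUnion.2 ⟨H, by simpa [S] using hH, by simpa using hx⟩
  calc Nat.card G = (Finset.univ : Finset G).card := by simp
    _ ≤ _ := Finset.card_le_card huniv
    _ ≤ _ := Finset.card_biUnion_le
    _ = _ := Finset.sum_congr rfl fun H _ => by
      rw [Set.toFinset_card, Nat.card_eq_fintype_card]; rfl

theorem mem_conj_orbit_of_sigma1_lt_three {G : Type*} [Group G] [Finite G] (h : sigma1 G < 3)
    {H K : Subgroup G} (hH : Subgroup.normalizer (H : Set G) = H)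
    (hK : Subgroup.normalizer (K : Set G) = K) (hHtop : H ≠ ⊤) (hKtop : K ≠ ⊤) :
    K ∈ MulAction.orbit (ConjAct G) H := by
  by_contra hKH
  have top_notMem {L : Subgroup G} (hL : L ≠ ⊤) : ⊤ ∉ MulAction.orbit (ConjAct G) L := fun hmem =>
    hL (Subgroup.eq_top_of_card_eq _
      ((card_eq_of_mem_conj_orbit hmem).symm.trans Subgroup.card_top))
  refine h.not_ge (three_le_sigma1 ?_ (top_notMem hHtop) (top_notMem hKtop)
    (finsum_card_conj_orbit hH).ge (finsum_card_conj_orbit hK).ge)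
  rw [Set.disjoint_left]
  intro L hLH hLK
  apply hKH
  rw [← MulAction.orbit_eq_iff] at hLH hLK ⊢
  rw [← hLK, hLH]

theorem stmt_9 (G : Type*) [Group G] [Finite G]
    (hnil : ¬Group.IsNilpotent G) (h : sigma1 G < 3) :
    IsSolvable G ∧
    ∃ (p : ℕ) (_ : p.Prime) (P : Sylow p G), (P : Subgroup G).Normal ∧
      ∃ K : Subgroup G, IsCyclic K ∧ Nat.card K = Nat.card G / Nat.card P ∧
        (P : Subgroup G) ⊓ K = ⊥ ∧ (P : Subgroup G) ⊔ K = ⊤ := by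
  obtain ⟨M, hM, hMn⟩ : ∃ M : Subgroup G, IsCoatom M ∧ ¬ M.Normal := by
    by_contra! hall
    exact hnil ((Group.isNilpotent_of_finite_tfae.out 0 2).2 hall)
  have hMN : Subgroup.normalizer (M : Set G) = M := by
    rcases hM.le_iff.1 M.le_normalizer with h | h
    · exact absurd (Subgroup.normalizer_eq_top_iff.1 h) hMn
    · exact h
  obtain ⟨p, hp, hpM⟩ := Nat.exists_prime_and_dvd
    (fun h1 => hM.1 (Subgroup.index_eq_one.1 h1) : M.index ≠ 1)
  have : Fact p.Prime := ⟨hp⟩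
  have not_le {P : Sylow p G} {L : Subgroup G} (hL : L ∈ MulAction.orbit (ConjAct G) M) :
      ¬ (P : Subgroup G) ≤ L := by
    intro hPL
    refine P.not_dvd_index (hpM.trans ?_)
    have hidx : M.index = L.index := by
      refine Nat.eq_of_mul_eq_mul_right (Nat.card_pos (α := M)) ?_
      rw [M.index_mul_card, ← card_eq_of_mem_conj_orbit hL, L.index_mul_card]
    exact hidx ▸ Subgroup.index_dvd_of_le hPL
  let P : Sylow p G := default
  have hP : (P : Subgroup G).Normal := by
    by_contra hPn
    exact not_le (mem_conj_orbit_of_sigma1_lt_three h hMN P.normalizer_normalizer hM.1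
      fun h => hPn (Subgroup.normalizer_eq_top_iff.1 h))
      (Subgroup.le_normalizer (H := (P : Subgroup G)))
  have hcyc : IsCyclic (G ⧸ (P : Subgroup G)) := by
    by_contra hcyc
    refine h.not_ge (three_le_sigma1 (A := MulAction.orbit (ConjAct G) M) ?_ ?_ ?_
      (finsum_card_conj_orbit hMN).ge (card_le_finsum_card_coatoms hcyc))
    · exact Set.disjoint_left.2 fun L hL hL' => not_le hL hL'.2
    · exact fun hmem => not_le (P := P) hmem le_top
    · exact fun hmem => hmem.1.1 rfl
  obtain ⟨K, hK⟩ := Subgroup.exists_right_complement'_of_coprime P.card_coprime_index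
  refine ⟨?_, p, hp, P, hP, K, ?_, ?_, hK.disjoint.eq_bot, hK.sup_eq_top⟩
  · have := hcyc.commGroup
    have : Group.IsSolvable (P : Subgroup G) := by
      have := P.isPGroup'.isNilpotent
      infer_instance
    exact Group.isSolvable_of_ker_le_range (P : Subgroup G).subtype
      (QuotientGroup.mk' (P : Subgroup G)) (by simp)
  · exact isCyclic_of_surjective _ (hK.symm.QuotientMulEquiv).surjective
  · exact (Nat.div_eq_of_eq_mul_right Nat.card_pos hK.card_mul_card.symm).symm
end

section
/- If G₁ and G₂ are finite groups of coprime orders, then σ₁(G₁ × G₂) = σ₁(G₁) · σ₁(G₂). -/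
theorem Subgroup.mk_one_mem_of_coprime_card {G N : Type*} [Group G] [Group N]
    (h : Nat.Coprime (Nat.card G) (Nat.card N)) {J : Subgroup (G × N)} {a : G} {b : N}
    (hab : (a, b) ∈ J) : (a, (1 : N)) ∈ J := by
  obtain ⟨k, hk₁, hk₂⟩ := Nat.chineseRemainder h 1 0
  have ha : a ^ k = a := by
    simpa using pow_eq_pow_iff_modEq.mpr (hk₁.of_dvd (_root_.orderOf_dvd_natCard a))
  have hb : b ^ k = 1 := by
    simpa using pow_eq_pow_iff_modEq.mpr (hk₂.of_dvd (_root_.orderOf_dvd_natCard b))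
  simpa [ha, hb] using J.pow_mem hab k

theorem Subgroup.prod_map_fst_map_snd_of_coprime_card {G N : Type*} [Group G] [Group N]
    (h : Nat.Coprime (Nat.card G) (Nat.card N)) (J : Subgroup (G × N)) :
    (J.map (MonoidHom.fst G N)).prod (J.map (MonoidHom.snd G N)) = J := by
  ext ⟨a, b⟩
  simp only [Subgroup.mem_prod, Subgroup.mem_map, MonoidHom.coe_fst, MonoidHom.coe_snd,
    Prod.exists, exists_eq_right, exists_and_right]
  refine ⟨?_, fun hab => ⟨⟨b, hab⟩, a, hab⟩⟩
  rintro ⟨⟨b', hb'⟩, a', ha'⟩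
  have hb : ((1 : G), b) ∈ J := by
    simpa using J.mul_mem (J.inv_mem (mk_one_mem_of_coprime_card h ha')) ha'
  simpa using J.mul_mem (mk_one_mem_of_coprime_card h hb') hb

/-- The subgroups of a product of two groups of coprime orders are the products of subgroups. -/
def Subgroup.prodEquivOfCoprimeCard {G N : Type*} [Group G] [Group N]
    (h : Nat.Coprime (Nat.card G) (Nat.card N)) :
    Subgroup G × Subgroup N ≃ Subgroup (G × N) where
  toFun p := p.1.prod p.2
  invFun J := (J.map (MonoidHom.fst G N), J.map (MonoidHom.snd G N))
  left_inv := by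
    rintro ⟨H, K⟩
    ext x
    · simpa [Subgroup.mem_prod] using fun _ => ⟨1, K.one_mem⟩
    · simpa [Subgroup.mem_prod] using fun _ => ⟨1, H.one_mem⟩
  right_inv := prod_map_fst_map_snd_of_coprime_card h

theorem stmt_13 (G₁ G₂ : Type*) [Group G₁] [Group G₂] [Finite G₁] [Finite G₂]
    (h : Nat.Coprime (Nat.card G₁) (Nat.card G₂)) :
    sigma1 (G₁ × G₂) = sigma1 G₁ * sigma1 G₂ := by
  have := Fintype.ofFinite (Subgroup G₁)
  have := Fintype.ofFinite (Subgroup G₂)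
  have hcard (p : Subgroup G₁ × Subgroup G₂) :
      (Nat.card (Subgroup.prodEquivOfCoprimeCard h p) : ℚ) = Nat.card p.1 * Nat.card p.2 := by
    rw [← Nat.cast_mul, ← Nat.card_prod]
    exact congrArg _ (Nat.card_congr (Subgroup.prodEquiv p.1 p.2).toEquiv)
  simp only [sigma1]
  rw [← finsum_comp_equiv (Subgroup.prodEquivOfCoprimeCard h)]
  simp only [hcard, finsum_eq_sum_of_fintype, Fintype.sum_prod_type, Nat.card_prod, Nat.cast_mul]
  rw [← Fintype.sum_mul_sum, mul_div_mul_comm]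
end

section
/- Let G be a finite group and N a normal subgroup of G. Then σ₁(G) ≥ σ₁(G/N) + (1/[G:N]) · (σ₁(N) − 1); in particular σ₁(G) ≥ σ₁(G/N). -/
theorem one_le_sigma1 (G : Type*) [Group G] [Finite G] : 1 ≤ sigma1 G := by
  have hG : (0 : ℚ) < Nat.card G := by exact_mod_cast Nat.card_pos
  rw [sigma1, one_le_div hG, ← Subgroup.card_top (G := G)]
  exact single_le_finsum (f := fun H : Subgroup G => (Nat.card H : ℚ)) ⊤
    (Set.toFinite _) fun _ => Nat.cast_nonneg _

theorem QuotientGroup.card_comap_mk' {G : Type*} [Group G] (N : Subgroup G) [N.Normal]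
    (K : Subgroup (G ⧸ N)) :
    Nat.card (K.comap (QuotientGroup.mk' N)) = Nat.card K * Nat.card N := by
  exact (Nat.card_congr
    (QuotientGroup.preimageMkEquivSubgroupProdSet N (K : Set (G ⧸ N)))).trans
    ((Nat.card_prod _ _).trans (mul_comm _ _))

theorem sum_card_subgroup_quotient_add_le (G : Type*) [Group G] [Finite G] (N : Subgroup G)
    [N.Normal] :
    (∑ᶠ K : Subgroup (G ⧸ N), (Nat.card K : ℚ)) * Nat.card N +
        ∑ᶠ L : Subgroup N, (Nat.card L : ℚ) ≤
      (∑ᶠ H : Subgroup G, (Nat.card H : ℚ)) + Nat.card N := by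
  classical
  have := Fintype.ofFinite (Subgroup G)
  have := Fintype.ofFinite (Subgroup (G ⧸ N))
  have := Fintype.ofFinite (Subgroup N)
  simp only [finsum_eq_sum_of_fintype]
  set A : Finset (Subgroup G) := Finset.univ.image (Subgroup.comap (QuotientGroup.mk' N))
  set B : Finset (Subgroup G) := Finset.univ.image (Subgroup.map N.subtype)
  have hA : ∑ H ∈ A, (Nat.card H : ℚ) =
      (∑ K : Subgroup (G ⧸ N), (Nat.card K : ℚ)) * Nat.card N := by
    rw [Finset.sum_image
      (Subgroup.comap_injective (QuotientGroup.mk'_surjective N)).injOn, Finset.sum_mul]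
    exact Finset.sum_congr rfl fun K _ => by
      rw [QuotientGroup.card_comap_mk', Nat.cast_mul]
  have hB : ∑ H ∈ B, (Nat.card H : ℚ) = ∑ L : Subgroup N, (Nat.card L : ℚ) := by
    rw [Finset.sum_image (Subgroup.map_injective N.subtype_injective).injOn]
    exact Finset.sum_congr rfl fun L _ => by
      rw [Subgroup.card_map_of_injective N.subtype_injective]
  have hAB : A ∩ B ⊆ {N} := by
    intro H hH
    simp only [A, B, Finset.mem_inter, Finset.mem_image, Finset.mem_univ, true_and] at hH
    obtain ⟨⟨K, rfl⟩, L, hL⟩ := hH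
    rw [Finset.mem_singleton]
    refine le_antisymm (hL ▸ Subgroup.map_subtype_le L) ?_
    exact QuotientGroup.le_comap_mk' N K
  rw [← hA, ← hB, ← Finset.sum_union_inter]
  refine add_le_add ?_ ?_
  · exact Finset.sum_le_sum_of_subset_of_nonneg (Finset.subset_univ _)
      fun _ _ _ => Nat.cast_nonneg _
  · refine (Finset.sum_le_sum_of_subset_of_nonneg hAB
      fun _ _ _ => Nat.cast_nonneg _).trans_eq ?_
    rw [Finset.sum_singleton]

theorem stmt_14 (G : Type*) [Group G] [Finite G] (N : Subgroup G) [N.Normal] :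
    sigma1 (G ⧸ N) + (1 / (N.index : ℚ)) * (sigma1 N - 1) ≤ sigma1 G ∧
      sigma1 (G ⧸ N) ≤ sigma1 G := by
  have hi : (0 : ℚ) < N.index := by exact_mod_cast Nat.pos_of_ne_zero N.index_ne_zero_of_finite
  have hN : (0 : ℚ) < Nat.card N := by exact_mod_cast Nat.card_pos
  have main : sigma1 (G ⧸ N) + (1 / (N.index : ℚ)) * (sigma1 N - 1) ≤ sigma1 G := by
    have hsum := sum_card_subgroup_quotient_add_le G N
    simp only [sigma1]
    rw [← N.card_mul_index, ← N.index_eq_card, Nat.cast_mul, le_div_iff₀ (by positivity)]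
    field_simp
    linarith
  refine ⟨main, le_trans (le_add_of_nonneg_right ?_) main⟩
  exact mul_nonneg (by positivity) (sub_nonneg.2 (one_le_sigma1 N))
end

section
/- There exists a finite group G of order 56 (namely the Frobenius group F₈ = (ℤ/2)³ ⋊ ℤ/7) that is not supersolvable and satisfies σ₁(G) < σ₁(A₄) = 35/12. In particular, σ₁(G) < σ₁(A₄) does not imply that G is supersolvable. -/
def IsSupersolvable (G : Type*) [Group G] : Prop :=
  ∃ (n : ℕ) (H : Fin (n + 1) → Subgroup G) (hnorm : ∀ i, (H i).Normal),
    H 0 = ⊥ ∧ H (Fin.last n) = ⊤ ∧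
    ∀ i : Fin n,
      H i.castSucc ≤ H i.succ ∧
      letI := hnorm i.castSucc
      IsCyclic ((H i.succ).map (QuotientGroup.mk' (H i.castSucc)))

open Finset

open scoped Classical in
theorem card_filter_mem_subgroup {G : Type*} [Group G] [Fintype G] (H : Subgroup G) :
    #{x : G | x ∈ H} = Nat.card H := by
  rw [Nat.card_eq_fintype_card, Fintype.card_subtype]

open scoped Classical in
theorem card_filter_mem_subgroup_ne_one {G : Type*} [Group G] [Fintype G] (H : Subgroup G) :
    #{x : G | x ∈ H ∧ x ≠ 1} = Nat.card H - 1 := by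
  rw [← card_filter_mem_subgroup H, ← Finset.card_erase_of_mem (a := (1 : G)) (by simp)]
  congr 1
  ext x
  simp [and_comm]

open scoped Classical in
/-- Subgroups of prime order `p` partition the elements of order `p` into classes of size `p - 1`. -/
theorem card_subgroups_of_prime_card {G : Type*} [Group G] [Fintype G] {p : ℕ} (hp : p.Prime) :
    #{H : Subgroup G | Nat.card H = p} * (p - 1) = #{x : G | orderOf x = p} := by
  have key : ({x : G | orderOf x = p} : Finset G) =
      ({H : Subgroup G | Nat.card H = p} : Finset (Subgroup G)).biUnion
        (fun H => ({x : G | x ∈ H ∧ x ≠ 1} : Finset G)) := by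
    ext x
    simp only [mem_filter, mem_univ, true_and, mem_biUnion]
    constructor
    · intro hx
      refine ⟨Subgroup.zpowers x, by rw [Nat.card_zpowers, hx],
        Subgroup.mem_zpowers x, ?_⟩
      rintro rfl
      rw [orderOf_one] at hx
      exact hp.ne_one hx.symm
    · rintro ⟨H, hH, hx, h1⟩
      have := H.orderOf_dvd_natCard hx
      rw [hH, Nat.dvd_prime hp, orderOf_eq_one_iff] at this
      tauto
  rw [key, card_biUnion]
  · rw [sum_congr rfl (g := fun _ => p - 1)]
    · rw [sum_const, smul_eq_mul]
    · intro H hH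
      rw [card_filter_mem_subgroup_ne_one, (mem_filter.1 hH).2]
  · intro H hH K hK hne
    rw [Function.onFun, disjoint_left]
    intro x hxH hxK
    simp only [mem_filter, mem_univ, true_and, mem_coe] at hH hK hxH hxK
    have hord : orderOf x = p := by
      have := H.orderOf_dvd_natCard hxH.1
      rw [hH, Nat.dvd_prime hp, orderOf_eq_one_iff] at this
      tauto
    have hz : ∀ L : Subgroup G, Nat.card L = p → x ∈ L → Subgroup.zpowers x = L :=
      fun L hL hxL => Subgroup.eq_of_le_of_card_ge (by simpa using hxL)
        (by rw [Nat.card_zpowers, hord, hL])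
    exact hne ((hz H hH hxH.1).symm.trans (hz K hK hxK.1))

open scoped Classical in
/-- Each subgroup of order four contains six ordered pairs of distinct nontrivial elements, and
is determined by any of them. -/
theorem card_subgroups_of_card_four_le {G : Type*} [Group G] [Fintype G] (E : Subgroup G) :
    #{H : Subgroup G | Nat.card H = 4 ∧ H ≤ E} * 6 ≤
      (Nat.card E - 1) * (Nat.card E - 1) - (Nat.card E - 1) := by
  have key : ({H : Subgroup G | Nat.card H = 4 ∧ H ≤ E} : Finset (Subgroup G)).biUnion
        (fun H => ({x : G | x ∈ H ∧ x ≠ 1} : Finset G).offDiag) ⊆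
      ({x : G | x ∈ E ∧ x ≠ 1} : Finset G).offDiag := by
    rintro ⟨x, y⟩
    simp only [mem_biUnion, mem_filter, mem_univ, true_and, mem_offDiag]
    rintro ⟨H, ⟨-, hE⟩, ⟨hx, hx1⟩, ⟨hy, hy1⟩, hxy⟩
    exact ⟨⟨hE hx, hx1⟩, ⟨hE hy, hy1⟩, hxy⟩
  have hcard := card_le_card key
  rw [offDiag_card, card_filter_mem_subgroup_ne_one, card_biUnion] at hcard
  · refine le_trans (le_of_eq ?_) hcard
    rw [sum_congr rfl (g := fun _ => 6)]
    · rw [sum_const, smul_eq_mul]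
    · intro H hH
      rw [offDiag_card, card_filter_mem_subgroup_ne_one, (mem_filter.1 hH).2.1]
  · intro H hH K hK hne
    rw [Function.onFun, disjoint_left]
    rintro ⟨x, y⟩ hxH hxK
    simp only [mem_filter, mem_univ, true_and, mem_offDiag, mem_coe] at hH hK hxH hxK
    have hthree : 3 ≤ Nat.card (H ⊓ K : Subgroup G) := by
      rw [← card_filter_mem_subgroup, ← card_eq_three.2
        ⟨1, x, y, hxH.1.2.symm, hxH.2.1.2.symm, hxH.2.2, rfl⟩]
      apply card_le_card
      intro z hz
      simp only [mem_insert, mem_singleton] at hz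
      simp only [mem_filter, mem_univ, true_and, Subgroup.mem_inf]
      rcases hz with rfl | rfl | rfl
      · exact ⟨one_mem _, one_mem _⟩
      · exact ⟨hxH.1.1, hxK.1.1⟩
      · exact ⟨hxH.2.1.1, hxK.2.1.1⟩
    have hdvd : Nat.card (H ⊓ K : Subgroup G) ∣ 4 :=
      hH.1 ▸ Subgroup.card_dvd_of_le inf_le_left
    have hfour : 4 ≤ Nat.card (H ⊓ K : Subgroup G) := by
      have := Nat.le_of_dvd (by norm_num) hdvd
      interval_cases Nat.card (H ⊓ K : Subgroup G) <;> omega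
    exact hne ((Subgroup.eq_of_le_of_card_ge inf_le_left (hH.1.trans_le hfour)).symm.trans
      (Subgroup.eq_of_le_of_card_ge inf_le_right (hK.1.trans_le hfour)))

open scoped Classical in
theorem finsum_card_subgroup_eq_sum_divisors {G : Type*} [Group G] [Fintype G] :
    ∑ᶠ H : Subgroup G, (Nat.card H : ℚ) =
      ((∑ d ∈ (Nat.card G).divisors, d * #{H : Subgroup G | Nat.card H = d} : ℕ) : ℚ) := by
  rw [finsum_eq_sum_of_fintype, ← Nat.cast_sum]
  congr 1
  rw [← sum_fiberwise_of_maps_to (s := univ) (t := (Nat.card G).divisors)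
    (g := fun H : Subgroup G => Nat.card H)]
  · refine sum_congr rfl fun d _ => ?_
    rw [sum_congr rfl (g := fun _ => d) fun H hH => (mem_filter.1 hH).2, sum_const, smul_eq_mul,
      mul_comm]
  · intro H _
    exact Nat.mem_divisors.2 ⟨H.card_subgroup_dvd_card, Nat.card_pos.ne'⟩

/-- `E` is an elementary abelian `2`-subgroup of order `p + 1` and odd prime index `p` on whose
nontrivial elements every element outside `E` acts transitively by conjugation: the group is
sharply two-transitive of degree `p + 1` with `E` as its Frobenius kernel. -/
structure IsTransitiveKernel {G : Type*} [Group G] (E : Subgroup G) (p : ℕ) : Prop where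
  normal : E.Normal
  prime : p.Prime
  odd : Odd p
  sq_eq_one : ∀ x ∈ E, x ^ 2 = 1
  card_eq : Nat.card E = p + 1
  index_eq : E.index = p
  exists_conj : ∀ g, g ∉ E → ∀ a ∈ E, a ≠ 1 → ∀ b ∈ E, b ≠ 1 → ∃ n : ℕ, g ^ n * a * (g ^ n)⁻¹ = b

namespace IsTransitiveKernel

variable {G : Type*} [Group G] {E : Subgroup G} {p : ℕ}

theorem two_lt (hE : IsTransitiveKernel E p) : 2 < p := by
  have h2 := hE.prime.two_le
  obtain ⟨k, hk⟩ := hE.odd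
  omega

theorem natCard_eq (hE : IsTransitiveKernel E p) : Nat.card G = (p + 1) * p := by
  rw [← E.card_mul_index, hE.card_eq, hE.index_eq]

theorem ne_top (hE : IsTransitiveKernel E p) : E ≠ ⊤ := by
  intro h
  have := hE.index_eq
  rw [h, Subgroup.index_top] at this
  exact hE.prime.ne_one this.symm

theorem exists_ne_one (hE : IsTransitiveKernel E p) :
    ∃ a ∈ E, ∃ b ∈ E, a ≠ 1 ∧ b ≠ 1 ∧ a ≠ b := by
  have : Finite E := Nat.finite_of_card_ne_zero (by rw [hE.card_eq]; omega)
  have := Fintype.ofFinite E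
  have hcard : 2 < Fintype.card E := by
    rw [← Nat.card_eq_fintype_card, hE.card_eq]
    have := hE.two_lt
    omega
  obtain ⟨a, b, ha, hb, hab⟩ : ∃ a b : E, a ≠ 1 ∧ b ≠ 1 ∧ a ≠ b := by
    classical
    obtain ⟨a, ha⟩ := Fintype.exists_ne_of_one_lt_card (by omega : 1 < Fintype.card E) 1
    obtain ⟨b, -, hb⟩ := exists_mem_notMem_of_card_lt_card
      (s := ({1, a} : Finset E)) (t := univ) (lt_of_le_of_lt card_le_two hcard)
    simp only [mem_insert, mem_singleton, not_or] at hb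
    exact ⟨a, b, ha, hb.1, Ne.symm hb.2⟩
  exact ⟨a, a.2, b, b.2, by simpa using ha, by simpa using hb, by simpa using hab⟩

theorem exists_not_commute (hE : IsTransitiveKernel E p) {g : G} (hg : g ∉ E) :
    ∃ a ∈ E, ¬ Commute g a := by
  obtain ⟨a, ha, b, hb, ha1, hb1, hab⟩ := hE.exists_ne_one
  refine ⟨a, ha, fun hc => hab ?_⟩
  obtain ⟨n, hn⟩ := hE.exists_conj g hg a ha ha1 b hb hb1
  rwa [(hc.pow_left n).eq, mul_inv_cancel_right] at hn

theorem le_of_mem (hE : IsTransitiveKernel E p) {H : Subgroup G} {g a : G} (hg : g ∉ E)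
    (ha : a ∈ E) (ha1 : a ≠ 1) (hconj : ∀ n : ℕ, g ^ n * a * (g ^ n)⁻¹ ∈ H) :
    E ≤ H := by
  intro b hb
  by_cases hb1 : b = 1
  · exact hb1 ▸ one_mem H
  · obtain ⟨n, rfl⟩ := hE.exists_conj g hg a ha ha1 b hb hb1
    exact hconj n

theorem not_isCyclic (hE : IsTransitiveKernel E p) : ¬ IsCyclic E := by
  intro h
  have hexp := IsCyclic.exponent_eq_card (α := E)
  have hdvd : Monoid.exponent E ∣ 2 :=
    Monoid.exponent_dvd_of_forall_pow_eq_one fun x => Subtype.ext (hE.sq_eq_one x x.2)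
  rw [hexp, hE.card_eq] at hdvd
  have := Nat.le_of_dvd two_pos hdvd
  have := hE.two_lt
  omega

theorem subgroup_trichotomy (hE : IsTransitiveKernel E p) (H : Subgroup G) :
    H ≤ E ∨ H = ⊤ ∨ Nat.card H = p := by
  have := hE.normal
  by_cases hle : H ≤ E
  · exact Or.inl hle
  obtain ⟨x, hxH, hxE⟩ := SetLike.not_le_iff_exists.1 hle
  right
  by_cases hinf : ∃ a ∈ H, a ∈ E ∧ a ≠ 1
  · left
    obtain ⟨a, haH, haE, ha1⟩ := hinf
    have hEH : E ≤ H := hE.le_of_mem hxE haE ha1 fun n =>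
      mul_mem (mul_mem (pow_mem hxH n) haH) (inv_mem (pow_mem hxH n))
    have hmul := Subgroup.relIndex_mul_index hEH
    rw [hE.index_eq] at hmul
    rcases (Nat.dvd_prime hE.prime).1 (Dvd.intro_left _ hmul) with h | h
    · exact Subgroup.index_eq_one.1 h
    · rw [h] at hmul
      exact absurd (Subgroup.relIndex_eq_one.1 (Nat.eq_of_mul_eq_mul_right hE.prime.pos
        (hmul.trans (one_mul p).symm))) hle
  · right
    push Not at hinf
    have hinj : Function.Injective ((QuotientGroup.mk' E).comp H.subtype) := by
      rw [injective_iff_map_eq_one]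
      intro y hy
      simp only [MonoidHom.comp_apply, Subgroup.subtype_apply, QuotientGroup.mk'_apply,
        QuotientGroup.eq_one_iff] at hy
      exact Subtype.ext (hinf y y.2 hy)
    have hdvd := Subgroup.card_dvd_of_injective _ hinj
    rw [← Subgroup.index_eq_card, hE.index_eq] at hdvd
    refine ((Nat.dvd_prime hE.prime).1 hdvd).resolve_left fun h1 => hxE ?_
    rw [Subgroup.card_eq_one] at h1
    rw [h1, Subgroup.mem_bot] at hxH
    exact hxH ▸ one_mem E

theorem orderOf_eq_iff [Finite G] (hE : IsTransitiveKernel E p) (g : G) :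
    orderOf g = p ↔ g ∉ E := by
  constructor
  · intro hg hgE
    have h := E.orderOf_dvd_natCard hgE
    rw [hE.card_eq, hg, Nat.dvd_add_right dvd_rfl] at h
    exact hE.prime.one_lt.ne' (Nat.dvd_one.1 h)
  · intro hg
    rcases hE.subgroup_trichotomy (Subgroup.zpowers g) with h | h | h
    · exact absurd (h (Subgroup.mem_zpowers g)) hg
    · obtain ⟨a, -, ha⟩ := hE.exists_not_commute hg
      obtain ⟨k, rfl⟩ := Subgroup.mem_zpowers_iff.1 (h ▸ Subgroup.mem_top a)
      exact absurd (Commute.self_zpow g k) ha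
    · rwa [Nat.card_zpowers] at h

theorem orderOf_eq_two_iff [Finite G] (hE : IsTransitiveKernel E p) (g : G) :
    orderOf g = 2 ↔ g ∈ E ∧ g ≠ 1 := by
  constructor
  · intro hg
    refine ⟨by_contra fun h => ?_, ?_⟩
    · have := (hE.orderOf_eq_iff g).2 h
      have := hE.two_lt
      omega
    · rintro rfl
      simp at hg
  · rintro ⟨hg, h1⟩
    have := Fact.mk Nat.prime_two
    exact orderOf_eq_prime (hE.sq_eq_one g hg) h1

open scoped Classical in
theorem card_subgroups_of_card_prime [Fintype G] (hE : IsTransitiveKernel E p) :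
    #{H : Subgroup G | Nat.card H = p} = p + 1 := by
  have h := card_subgroups_of_prime_card (G := G) hE.prime
  have hset : #{x : G | orderOf x = p} = (p + 1) * (p - 1) := by
    have hcompl : ({x : G | orderOf x = p} : Finset G) = ({x : G | x ∈ E} : Finset G)ᶜ := by
      ext x
      simp [hE.orderOf_eq_iff]
    rw [hcompl, card_compl, card_filter_mem_subgroup, ← Nat.card_eq_fintype_card, hE.natCard_eq,
      hE.card_eq, Nat.mul_sub, mul_one]
  rw [hset] at h
  exact Nat.eq_of_mul_eq_mul_right (by have := hE.two_lt; omega) h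

open scoped Classical in
theorem card_subgroups_of_card_two [Fintype G] (hE : IsTransitiveKernel E p) :
    #{H : Subgroup G | Nat.card H = 2} = p := by
  have h := card_subgroups_of_prime_card (G := G) Nat.prime_two
  simp only [hE.orderOf_eq_two_iff, card_filter_mem_subgroup_ne_one, hE.card_eq] at h
  simpa using h

open scoped Classical in
theorem card_subgroups_of_card_one [Fintype G] : #{H : Subgroup G | Nat.card H = 1} = 1 := by
  rw [card_eq_one]
  refine ⟨⊥, ?_⟩
  ext H
  rw [mem_filter, mem_singleton, Subgroup.card_eq_one]
  simp

open scoped Classical in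
theorem card_subgroups_of_card_group [Fintype G] {n : ℕ} (hn : Nat.card G = n) :
    #{H : Subgroup G | Nat.card H = n} = 1 := by
  rw [card_eq_one]
  refine ⟨⊤, ?_⟩
  ext H
  simp only [mem_filter, mem_univ, true_and, mem_singleton]
  exact ⟨fun h => H.eq_top_of_card_eq (h.trans hn.symm), fun h => by
    rw [h, Subgroup.card_top, hn]⟩

theorem le_of_card [Finite G] (hE : IsTransitiveKernel E p) {H : Subgroup G}
    (h1 : Nat.card H ≠ p) (h2 : Nat.card H ≠ Nat.card G) : H ≤ E := by
  rcases hE.subgroup_trichotomy H with h | rfl | h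
  · exact h
  · exact absurd Subgroup.card_top h2
  · exact absurd h h1

open scoped Classical in
theorem card_subgroups_of_card_kernel [Fintype G] (hE : IsTransitiveKernel E p) {n : ℕ}
    (hn : n = p + 1) : #{H : Subgroup G | Nat.card H = n} = 1 := by
  subst hn
  rw [card_eq_one]
  refine ⟨E, ?_⟩
  ext H
  simp only [mem_filter, mem_univ, true_and, mem_singleton]
  refine ⟨fun h => ?_, fun h => by rw [h, hE.card_eq]⟩
  refine Subgroup.eq_of_le_of_card_ge (hE.le_of_card (by omega) ?_) (by rw [h, hE.card_eq])
  rw [h, hE.natCard_eq]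
  have := hE.two_lt
  nlinarith

open scoped Classical in
theorem card_subgroups_eq_zero [Fintype G] (hE : IsTransitiveKernel E p) {n : ℕ}
    (h1 : n ≠ p) (h2 : n ≠ (p + 1) * p) (h3 : ¬ n ∣ p + 1) :
    #{H : Subgroup G | Nat.card H = n} = 0 := by
  rw [card_eq_zero, filter_eq_empty_iff]
  rintro H - rfl
  have hle : H ≤ E := hE.le_of_card h1 (hE.natCard_eq ▸ h2)
  exact h3 (hE.card_eq ▸ Subgroup.card_dvd_of_le hle)

theorem not_isCyclic_of_normal (hE : IsTransitiveKernel E p) {N : Subgroup G} (hN : N.Normal)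
    (hne : N ≠ ⊥) : ¬ IsCyclic N := by
  intro hcyc
  have := hE.normal
  obtain ⟨g, -, hg⟩ := SetLike.exists_of_lt hE.ne_top.lt_top
  by_cases hinf : ∃ a ∈ N, a ∈ E ∧ a ≠ 1
  · obtain ⟨a, haN, haE, ha1⟩ := hinf
    have hEN : E ≤ N := hE.le_of_mem hg haE ha1 fun n => hN.conj_mem a haN (g ^ n)
    exact hE.not_isCyclic
      (isCyclic_of_injective (Subgroup.inclusion hEN) (Subgroup.inclusion_injective hEN))
  · push Not at hinf
    have hdisj : Disjoint N E :=
      Subgroup.disjoint_def.2 fun {x} hx hxE => hinf x hx hxE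
    obtain ⟨x, hx, hx1⟩ := N.bot_or_exists_ne_one.resolve_left hne
    obtain ⟨a, ha, hnc⟩ := hE.exists_not_commute (fun hxE => hx1 (hinf x hx hxE))
    exact hnc (Subgroup.commute_of_normal_of_disjoint N E hN hE.normal hdisj x a hx ha)

theorem not_isSupersolvable (hE : IsTransitiveKernel E p) : ¬ IsSupersolvable G := by
  rintro ⟨n, H, hnorm, h0, hlast, hstep⟩
  have hbot : ∀ i, H i = ⊥ := by
    intro i
    induction i using Fin.induction with
    | zero => exact h0
    | succ i ih =>
      by_contra hne
      refine hE.not_isCyclic_of_normal (hnorm i.succ) hne ?_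
      have hcyc := (hstep i).2
      have := hnorm i.castSucc
      have hinj : Function.Injective (QuotientGroup.mk' (H i.castSucc)) := by
        rw [← MonoidHom.ker_eq_bot_iff, QuotientGroup.ker_mk', ih]
      exact (MulEquiv.isCyclic ((H i.succ).equivMapOfInjective _ hinj)).2 hcyc
  obtain ⟨a, -, b, -, ha, -⟩ := hE.exists_ne_one
  refine ha ?_
  rw [← Subgroup.mem_bot, ← hbot (Fin.last n), hlast]
  exact Subgroup.mem_top a

end IsTransitiveKernel

theorem sigma1_of_isTransitiveKernel_three {G : Type*} [Group G] [Fintype G] {E : Subgroup G}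
    (hE : IsTransitiveKernel E 3) : sigma1 G = 35 / 12 := by
  have hG : Nat.card G = 12 := hE.natCard_eq
  have hdiv : Nat.divisors 12 = {1, 2, 3, 4, 6, 12} := by decide
  rw [sigma1, finsum_card_subgroup_eq_sum_divisors, hG, hdiv]
  simp only [mem_insert, mem_singleton, not_false_eq_true, sum_insert, sum_singleton,
    OfNat.one_ne_ofNat, or_self, Nat.reduceEqDiff]
  rw [IsTransitiveKernel.card_subgroups_of_card_one, hE.card_subgroups_of_card_two,
    hE.card_subgroups_of_card_prime, hE.card_subgroups_of_card_kernel rfl,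
    hE.card_subgroups_eq_zero (n := 6) (by norm_num) (by norm_num) (by norm_num),
    IsTransitiveKernel.card_subgroups_of_card_group hG]
  norm_num

theorem sigma1_le_of_isTransitiveKernel_seven {G : Type*} [Group G] [Fintype G] {E : Subgroup G}
    (hE : IsTransitiveKernel E 7) : sigma1 G ≤ 163 / 56 := by
  classical
  have hG : Nat.card G = 56 := hE.natCard_eq
  have hdiv : Nat.divisors 56 = {1, 2, 4, 7, 8, 14, 28, 56} := by decide +kernel
  have hfour : #{H : Subgroup G | Nat.card H = 4} ≤ 7 := by
    have h := card_subgroups_of_card_four_le E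
    rw [hE.card_eq] at h
    have heq : ({H : Subgroup G | Nat.card H = 4} : Finset (Subgroup G)) =
        ({H : Subgroup G | Nat.card H = 4 ∧ H ≤ E} : Finset (Subgroup G)) := by
      refine filter_congr fun H _ => ⟨fun hH => ⟨hH, hE.le_of_card ?_ ?_⟩, fun hH => hH.1⟩ <;> omega
    rw [heq]
    omega
  rw [sigma1, finsum_card_subgroup_eq_sum_divisors, hG, hdiv, Nat.cast_ofNat]
  refine div_le_div_of_nonneg_right ?_ (by norm_num)
  simp only [mem_insert, mem_singleton, not_false_eq_true, sum_insert, sum_singleton,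
    OfNat.one_ne_ofNat, or_self, Nat.reduceEqDiff]
  rw [IsTransitiveKernel.card_subgroups_of_card_one, hE.card_subgroups_of_card_two,
    hE.card_subgroups_of_card_prime, hE.card_subgroups_of_card_kernel rfl,
    hE.card_subgroups_eq_zero (n := 14) (by norm_num) (by norm_num) (by norm_num),
    hE.card_subgroups_eq_zero (n := 28) (by norm_num) (by norm_num) (by norm_num),
    IsTransitiveKernel.card_subgroups_of_card_group hG]
  norm_cast
  omega

/-- The elements of `A₄` with trivial square form its Klein four-subgroup. -/
def alternatingFourKernel : Subgroup (alternatingGroup (Fin 4)) where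
  carrier := {g | g ^ 2 = 1}
  one_mem' := one_pow 2
  mul_mem' := fun {a b} => by
    have h : ∀ a : alternatingGroup (Fin 4), a ^ 2 = 1 →
      ∀ b : alternatingGroup (Fin 4), b ^ 2 = 1 → (a * b) ^ 2 = 1 := by decide +kernel
    exact fun ha hb => h a ha b hb
  inv_mem' := fun {a} ha => by
    simp only [Set.mem_ofPred_eq] at ha ⊢
    rw [inv_pow, ha, inv_one]

theorem mem_alternatingFourKernel {g : alternatingGroup (Fin 4)} :
    g ∈ alternatingFourKernel ↔ g ^ 2 = 1 := Iff.rfl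

theorem isTransitiveKernel_alternatingFourKernel : IsTransitiveKernel alternatingFourKernel 3 := by
  have hcard : Nat.card alternatingFourKernel = 4 := by
    have h : #{g : alternatingGroup (Fin 4) | g ^ 2 = 1} = 4 := by decide +kernel
    classical
    rw [← card_filter_mem_subgroup]
    refine Eq.trans (congrArg card ?_) h
    ext g
    simp [mem_alternatingFourKernel]
  refine ⟨⟨fun a ha g => ?_⟩, Nat.prime_three, by decide, fun x hx => hx, hcard, ?_, ?_⟩
  · rw [mem_alternatingFourKernel] at ha ⊢
    rw [conj_pow, ha, mul_one, mul_inv_cancel]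
  · have h := alternatingFourKernel.card_mul_index
    have h12 : Nat.card (alternatingGroup (Fin 4)) = 12 :=
      alternatingGroup.card_of_card_eq_four (by simp)
    rw [hcard, h12] at h
    omega
  · have h : ∀ g : alternatingGroup (Fin 4), g ^ 2 ≠ 1 →
        ∀ a : alternatingGroup (Fin 4), a ^ 2 = 1 → a ≠ 1 →
        ∀ b : alternatingGroup (Fin 4), b ^ 2 = 1 → b ≠ 1 →
        ∃ n : Fin 3, g ^ (n : ℕ) * a * (g ^ (n : ℕ))⁻¹ = b := by decide +kernel
    intro g hg a ha ha1 b hb hb1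
    obtain ⟨n, hn⟩ := h g hg a ha ha1 b hb hb1
    exact ⟨n, hn⟩

/-- The action of the units of a field on its additive group by multiplication. -/
def unitsMulAut (F : Type*) [Field F] : Fˣ →* MulAut (Multiplicative F) :=
  (MulAutMultiplicative F).symm.toMonoidHom.comp (DistribMulAction.toAddAut Fˣ F)

theorem unitsMulAut_apply {F : Type*} [Field F] (u : Fˣ) (x : F) :
    unitsMulAut F u (Multiplicative.ofAdd x) = Multiplicative.ofAdd ((u : F) * x) := rfl

theorem isTransitiveKernel_range_inl {F : Type*} [Field F] [CharP F 2] {p : ℕ} (hp : p.Prime)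
    (hodd : Odd p) (hF : Nat.card F = p + 1) :
    IsTransitiveKernel (SemidirectProduct.inl (φ := unitsMulAut F)).range p := by
  have : Finite F := Nat.finite_of_card_ne_zero (by omega)
  have hunits : Nat.card Fˣ = p := by rw [Nat.card_units, hF, Nat.add_sub_cancel]
  refine ⟨?_, hp, hodd, ?_, ?_, ?_, ?_⟩
  · rw [SemidirectProduct.range_inl_eq_ker_rightHom]
    infer_instance
  · rintro _ ⟨x, rfl⟩
    rw [← map_pow]
    have : x ^ 2 = 1 := by
      rw [pow_two]
      exact CharTwo.add_self_eq_zero x.toAdd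
    rw [this, map_one]
  · rw [← hF]
    exact (Nat.card_congr (MonoidHom.ofInjective
      (SemidirectProduct.inl_injective (φ := unitsMulAut F))).toEquiv).symm
  · rw [SemidirectProduct.range_inl_eq_ker_rightHom, Subgroup.index_ker,
      MonoidHom.range_eq_top.2 SemidirectProduct.rightHom_surjective, Subgroup.card_top, hunits]
  · rintro g hg _ ⟨x, rfl⟩ hx _ ⟨y, rfl⟩ hy
    rw [SemidirectProduct.range_inl_eq_ker_rightHom, MonoidHom.mem_ker,
      SemidirectProduct.rightHom_eq_right] at hg
    have hx0 : x.toAdd ≠ 0 := fun h => hx (by rw [toAdd_eq_zero.1 h, map_one])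
    have hy0 : y.toAdd ≠ 0 := fun h => hy (by rw [toAdd_eq_zero.1 h, map_one])
    have := Fact.mk hp
    obtain ⟨n, hn⟩ : ∃ n : ℕ, g.right ^ n = Units.mk0 _ hy0 / Units.mk0 _ hx0 := by
      have hmem := mem_powers_of_prime_card hunits hg (g' := Units.mk0 _ hy0 / Units.mk0 _ hx0)
      exact Submonoid.mem_powers_iff _ _ |>.1 hmem
    refine ⟨n, ?_⟩
    have hr : (g ^ n).right = g.right ^ n := map_pow SemidirectProduct.rightHom g n
    apply SemidirectProduct.ext
    · simp only [SemidirectProduct.mul_left, SemidirectProduct.mul_right,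
        SemidirectProduct.left_inl, SemidirectProduct.right_inl, mul_one,
        SemidirectProduct.inv_left, hr, map_inv]
      have hxy : unitsMulAut F (g.right ^ n) x = y := by
        rw [hn]
        refine (unitsMulAut_apply _ x.toAdd).trans ?_
        rw [Units.val_div_eq_div_val, Units.val_mk0, Units.val_mk0, div_mul_cancel₀ _ hx0]
        rfl
      rw [hxy]
      simp [mul_comm]
    · simp

theorem stmt_17 :
    (∃ (G : Type) (_ : Group G), Finite G ∧ Nat.card G = 56 ∧
      ¬IsSupersolvable G ∧ sigma1 G < sigma1 (alternatingGroup (Fin 4))) ∧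
    sigma1 (alternatingGroup (Fin 4)) = 35 / 12 := by
  have hA := sigma1_of_isTransitiveKernel_three isTransitiveKernel_alternatingFourKernel
  refine ⟨?_, hA⟩
  have hE := isTransitiveKernel_range_inl (F := GaloisField 2 3) (p := 7) (by norm_num)
    (by decide) (by rw [GaloisField.card 2 3 (by norm_num)]; norm_num)
  have hG := hE.natCard_eq
  have hfin := Nat.finite_of_card_ne_zero (hG.trans_ne (by norm_num))
  have := Fintype.ofFinite (Multiplicative (GaloisField 2 3) ⋊[unitsMulAut _] (GaloisField 2 3)ˣ)
  refine ⟨_, inferInstance, hfin, hG, hE.not_isSupersolvable, ?_⟩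
  rw [hA]
  exact (sigma1_le_of_isTransitiveKernel_seven hE).trans_lt (by norm_num)
end

section
/- Let G be a finite group. If σ₁(G) ≤ 2, then G is cyclic. -/
/-- In a non-cyclic finite group the orders of the subgroups sum to more than `2 * |G|`: each `x`
lies in `⊤` and in the proper subgroup it generates, and `1` lies in every subgroup. -/
theorem two_mul_card_lt_finsum_card_subgroup (G : Type*) [Group G] [Finite G]
    (hG : ¬ IsCyclic G) :
    2 * Nat.card G < ∑ᶠ H : Subgroup G, Nat.card H := by
  have hz (x : G) : Subgroup.zpowers x ≠ ⊤ := fun hx =>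
    hG ⟨x, (Subgroup.eq_top_iff' _).mp hx⟩
  have : Nontrivial G := not_subsingleton_iff_nontrivial.mp fun _ => hG inferInstance
  obtain ⟨g, hg⟩ := exists_ne (1 : G)
  let f : Option (G ⊕ G) → Σ H : Subgroup G, H
    | none => ⟨Subgroup.zpowers g, 1⟩
    | some (Sum.inl x) => ⟨⊤, ⟨x, Subgroup.mem_top x⟩⟩
    | some (Sum.inr x) => ⟨Subgroup.zpowers x, ⟨x, Subgroup.mem_zpowers x⟩⟩
  have hf : Function.Injective f := by
    intro a b hab
    have h₁ : (f a).1 = (f b).1 := congrArg Sigma.fst hab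
    have h₂ : ((f a).2 : G) = (f b).2 :=
      congrArg (fun p : Σ H : Subgroup G, H => (p.2 : G)) hab
    rcases a with _ | x | x <;> rcases b with _ | y | y <;> simp only [f] at h₁ h₂
    · rfl
    · exact (hz _ h₁).elim
    · rw [OneMemClass.coe_one] at h₂
      subst h₂
      exact (hg (by simpa using h₁)).elim
    · exact (hz _ h₁.symm).elim
    · rw [h₂]
    · exact (hz _ h₁.symm).elim
    · rw [OneMemClass.coe_one] at h₂
      subst h₂
      exact (hg (by simpa using h₁.symm)).elim
    · exact (hz _ h₁).elim
    · rw [h₂]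
  have hcard := Nat.card_le_card_of_injective f hf
  have := Fintype.ofFinite (Subgroup G)
  rw [Finite.card_option, Nat.card_sum, Nat.card_sigma] at hcard
  rw [finsum_eq_sum_of_fintype]
  omega

theorem stmt_18 (G : Type*) [Group G] [Finite G] (h : sigma1 G ≤ 2) :
    IsCyclic G := by
  by_contra hG
  have hlt := two_mul_card_lt_finsum_card_subgroup G hG
  have := Fintype.ofFinite (Subgroup G)
  rw [sigma1, div_le_iff₀ (by exact_mod_cast Nat.card_pos), finsum_eq_sum_of_fintype] at h
  rw [finsum_eq_sum_of_fintype] at hlt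
  exact hlt.not_ge (by exact_mod_cast h)
end

section
/- Let G be a finite group. If σ₁(G) < 2 + 4/|G|, then G is nilpotent. -/
open scoped Pointwise in
theorem Subgroup.card_conjAct_orbit_mul_card {G : Type*} [Group G] [Finite G] {M : Subgroup G}
    (hM : IsCoatom M) (hn : ¬ M.Normal) :
    Nat.card (MulAction.orbit (ConjAct G) M) * Nat.card M = Nat.card G := by
  have hnorm : Subgroup.normalizer (M : Set G) = M := by
    rcases hM.le_iff.mp (Subgroup.le_normalizer (H := M)) with h | h
    · exact absurd (Subgroup.normalizer_eq_top_iff.mp h) hn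
    · exact h
  have hst : Nat.card (MulAction.stabilizer (ConjAct G) M) = Nat.card M := by
    refine Nat.card_congr
      (Equiv.subtypeEquiv (ConjAct.ofConjAct (G := G)).toEquiv fun g => ?_)
    have h := Subgroup.conjAct_pointwise_smul_iff (H := M) (g := ConjAct.ofConjAct g)
    rw [hnorm] at h
    exact h
  rw [← hst, ← Nat.card_prod]
  exact Nat.card_congr (MulAction.orbitProdStabilizerEquivGroup (ConjAct G) M)

/-- A non-normal subgroup of a finite group has index divisible by a prime whose Sylow subgroups
have order at least three. -/
theorem Subgroup.exists_prime_dvd_index_three_le_card_sylow {G : Type*} [Group G] [Finite G]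
    {M : Subgroup G} (hn : ¬ M.Normal) :
    ∃ p : ℕ, p.Prime ∧ p ∣ M.index ∧ ∀ P : Sylow p G, 3 ≤ Nat.card P := by
  have h0 : M.index ≠ 0 := Subgroup.index_ne_zero_of_finite
  have h1 : M.index ≠ 1 := fun h => hn (Subgroup.index_eq_one.mp h ▸ inferInstance)
  have h2 : M.index ≠ 2 := fun h => hn (Subgroup.normal_of_index_eq_two h)
  rcases Nat.four_dvd_or_exists_odd_prime_and_dvd_of_two_lt (n := M.index) (by omega) with
    h4 | ⟨p, hp, hd, ho⟩
  · refine ⟨2, Nat.prime_two, dvd_trans (by norm_num) h4, fun P => ?_⟩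
    have : Fact (Nat.Prime 2) := ⟨Nat.prime_two⟩
    have := Nat.le_of_dvd Nat.card_pos
      (P.pow_dvd_card_of_pow_dvd_card (n := 2) (h4.trans M.index_dvd_card))
    omega
  · refine ⟨p, hp, hd, fun P => ?_⟩
    have : Fact p.Prime := ⟨hp⟩
    have := Nat.le_of_dvd Nat.card_pos (P.dvd_card_of_dvd_card (hd.trans M.index_dvd_card))
    have := hp.two_le
    obtain ⟨k, rfl⟩ := ho
    omega

open scoped Pointwise in
theorem two_mul_card_add_four_le_sum_card {G : Type*} [Group G] [Finite G]
    [Fintype (Subgroup G)] (h : ¬ Group.IsNilpotent G) :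
    2 * Nat.card G + 4 ≤ ∑ H : Subgroup G, Nat.card H := by
  classical
  obtain ⟨M, hM, hn⟩ : ∃ M : Subgroup G, IsCoatom M ∧ ¬ M.Normal := by
    by_contra! hc
    exact h ((Group.isNilpotent_of_finite_tfae.out 0 2 rfl rfl).mpr hc)
  obtain ⟨p, hp, hd, hP3⟩ := Subgroup.exists_prime_dvd_index_three_le_card_sylow hn
  have : Fact p.Prime := ⟨hp⟩
  obtain ⟨P⟩ : Nonempty (Sylow p G) := inferInstance
  specialize hP3 P
  have hcard : ∀ H ∈ (MulAction.orbit (ConjAct G) M).toFinset, Nat.card H = Nat.card M := by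
    intro H hH
    obtain ⟨g, rfl⟩ := Set.mem_toFinset.mp hH
    exact (Nat.card_congr (Subgroup.equivSMul g M).toEquiv).symm
  have hsum : ∑ H ∈ (MulAction.orbit (ConjAct G) M).toFinset, Nat.card H = Nat.card G := by
    rw [Finset.sum_congr rfl hcard, Finset.sum_const, smul_eq_mul, Set.toFinset_card,
      ← Nat.card_eq_fintype_card, Subgroup.card_conjAct_orbit_mul_card hM hn]
  have hPC : (P : Subgroup G) ∉ (MulAction.orbit (ConjAct G) M).toFinset := by
    intro hmem
    have hi : P.index = M.index := by
      have h1 := P.index_mul_card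
      have h2 := M.index_mul_card
      rw [hcard _ hmem] at h1
      exact Nat.eq_of_mul_eq_mul_right Nat.card_pos (h1.trans h2.symm)
    exact P.not_dvd_index (hi ▸ hd)
  have hPtop : (P : Subgroup G) ≠ ⊤ := by
    intro ht
    have hG : IsPGroup p G := by
      have := P.isPGroup'
      rw [ht] at this
      exact this.of_equiv Subgroup.topEquiv
    exact h hG.isNilpotent
  have hbC : (⊥ : Subgroup G) ∉
      insert (P : Subgroup G) (MulAction.orbit (ConjAct G) M).toFinset := by
    rw [Finset.mem_insert, not_or]
    refine ⟨fun hb => ?_, fun hmem => ?_⟩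
    · have : Nat.card (P : Subgroup G) = 1 := by rw [← hb, Subgroup.card_bot]
      omega
    · have := hcard _ hmem
      rw [Subgroup.card_bot] at this
      exact hn (Subgroup.card_eq_one.mp this.symm ▸ inferInstance)
  have htC : (⊤ : Subgroup G) ∉ insert (⊥ : Subgroup G)
      (insert (P : Subgroup G) (MulAction.orbit (ConjAct G) M).toFinset) := by
    rw [Finset.mem_insert, Finset.mem_insert, not_or, not_or]
    refine ⟨fun hb => hPtop (top_le_iff.mp (hb.trans_le bot_le)), hPtop.symm, fun hmem => ?_⟩
    have := hcard _ hmem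
    rw [Subgroup.card_top] at this
    exact hM.1 (Subgroup.eq_top_of_card_eq M this.symm)
  refine le_trans ?_ (Finset.sum_le_sum_of_subset (Finset.subset_univ (insert (⊤ : Subgroup G)
    (insert ⊥ (insert (P : Subgroup G) (MulAction.orbit (ConjAct G) M).toFinset)))))
  rw [Finset.sum_insert htC, Finset.sum_insert hbC, Finset.sum_insert hPC, hsum,
    Subgroup.card_top, Subgroup.card_bot]
  omega

theorem stmt_19 (G : Type*) [Group G] [Finite G]
    (h : sigma1 G < 2 + 4 / (Nat.card G : ℚ)) :
    Group.IsNilpotent G := by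
  by_contra hG
  have : Fintype (Subgroup G) := Fintype.ofFinite _
  have hpos : (0 : ℚ) < Nat.card G := Nat.cast_pos.mpr Nat.card_pos
  have hle : (2 * Nat.card G + 4 : ℚ) ≤ ∑ H : Subgroup G, (Nat.card H : ℚ) := by
    exact_mod_cast two_mul_card_add_four_le_sum_card hG
  rw [sigma1, finsum_eq_sum_of_fintype, div_lt_iff₀ hpos, add_mul,
    div_mul_cancel₀ _ hpos.ne'] at h
  exact absurd h hle.not_gt
end
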